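/- arXiv:1102.4421 — 2 statements merged into one kernel-verified Lean document; each statement's English description precedes it below -/
import Mathlib

section
/- Let Ω be a finite set, G a primitive permutation group on Ω, and Γ ⊆ Ω a Jordan set for G (i.e., |Γ| > 1 and some subgroup of G fixes Ω∖Γ pointwise and is transitive on Γ) with |Γ| < |Ω|/2. Then Alt(Ω) ≤ G. (Marggraff's theorem, used in the construction.) -/
open Equiv Subgroup

/-- A subgroup of `Perm Ω` is transitive on `Ω`. -/
def transOnAll {Ω : Type*} (G : Subgroup (Equiv.Perm Ω)) : Prop :=
  ∀ u v : Ω, ∃ g ∈ G, g u = v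

/-- A subgroup of `Perm Ω` is primitive: transitive and with no nontrivial blocks. -/
def isPrimitiveSub {Ω : Type*} (G : Subgroup (Equiv.Perm Ω)) : Prop :=
  transOnAll G ∧
    ∀ B : Set Ω, (∀ g ∈ G, (fun ω => g ω) '' B = B ∨ Disjoint ((fun ω => g ω) '' B) B) →
      B.Subsingleton ∨ B = Set.univ

/-- `Γ` is a Jordan set for `G`: `|Γ| > 1` and some subgroup of `G` fixes `Ω \ Γ`
pointwise and acts transitively on `Γ`. -/
def isJordanSet {Ω : Type*} (G : Subgroup (Equiv.Perm Ω)) (Γ : Set Ω) : Prop :=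
  1 < Γ.ncard ∧
    ∃ K : Subgroup (Equiv.Perm Ω), K ≤ G ∧ (∀ g ∈ K, ∀ z ∉ Γ, g z = z) ∧
      ∀ u ∈ Γ, ∀ v ∈ Γ, ∃ g ∈ K, g u = v

open scoped Pointwise

/-- `X` is (weakly) a Jordan set, with the empty set and singletons allowed. -/
def JS {Ω : Type*} (G : Subgroup (Equiv.Perm Ω)) (X : Finset Ω) : Prop :=
  ∀ u ∈ X, ∀ v ∈ X, ∃ g ∈ G, (∀ z, z ∉ X → g z = z) ∧ g u = v

set_option linter.unusedSectionVars false

section marg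
variable {Ω : Type*} [Fintype Ω] [DecidableEq Ω] {G : Subgroup (Equiv.Perm Ω)}

theorem mem_sm {g : Equiv.Perm Ω} {X : Finset Ω} {x : Ω} : g x ∈ g • X ↔ x ∈ X :=
  Finset.smul_mem_smul_finset_iff (s := X) (b := x) g

theorem mem_sm' {g : Equiv.Perm Ω} {X : Finset Ω} {x : Ω} : x ∈ g • X ↔ g⁻¹ x ∈ X :=
  (Finset.inv_smul_mem_iff (s := X) (b := x) (a := g)).symm

theorem disj_sm {g : Equiv.Perm Ω} {X Y : Finset Ω} :
    Disjoint (g • X) (g • Y) ↔ Disjoint X Y := by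
  rw [Finset.disjoint_iff_inter_eq_empty, Finset.disjoint_iff_inter_eq_empty,
    ← Finset.smul_finset_inter, Finset.smul_finset_eq_empty]

theorem JS.smul {X : Finset Ω} (h : JS G X) {g : Equiv.Perm Ω} (hg : g ∈ G) : JS G (g • X) := by
  intro u hu v hv
  rw [mem_sm'] at hu hv
  obtain ⟨k, hk, hf, e⟩ := h _ hu _ hv
  refine ⟨g * k * g⁻¹, G.mul_mem (G.mul_mem hg hk) (G.inv_mem hg), ?_, ?_⟩
  · intro z hz
    rw [mem_sm'] at hz
    rw [Equiv.Perm.mul_apply, Equiv.Perm.mul_apply, hf _ hz]; exact Equiv.apply_symm_apply g _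
  · rw [Equiv.Perm.mul_apply, Equiv.Perm.mul_apply, e]; exact Equiv.apply_symm_apply g _

theorem JS.union {X Y : Finset Ω} (hX : JS G X) (hY : JS G Y) (h : ¬ Disjoint X Y) :
    JS G (X ∪ Y) := by
  rw [Finset.not_disjoint_iff] at h
  obtain ⟨w, hwX, hwY⟩ := h
  have key : ∀ u ∈ X ∪ Y, ∃ g ∈ G, (∀ z, z ∉ X ∪ Y → g z = z) ∧ g u = w := by
    intro u hu
    rcases Finset.mem_union.1 hu with hu | hu
    · obtain ⟨g, hg, hf, e⟩ := hX u hu w hwX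
      exact ⟨g, hg, fun z hz => hf z (fun h => hz (Finset.mem_union_left _ h)), e⟩
    · obtain ⟨g, hg, hf, e⟩ := hY u hu w hwY
      exact ⟨g, hg, fun z hz => hf z (fun h => hz (Finset.mem_union_right _ h)), e⟩
  intro u hu v hv
  obtain ⟨g, hg, hf, e⟩ := key u hu
  obtain ⟨k, hk, hf', e'⟩ := key v hv
  refine ⟨k⁻¹ * g, G.mul_mem (G.inv_mem hk) hg, ?_, ?_⟩
  · intro z hz
    rw [Equiv.Perm.mul_apply, hf z hz, Equiv.Perm.inv_eq_iff_eq, hf' z hz]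
  · rw [Equiv.Perm.mul_apply, e, Equiv.Perm.inv_eq_iff_eq, e']

theorem stab_of_fix {X Y : Finset Ω} (h : X ⊆ Y) {g : Equiv.Perm Ω}
    (hf : ∀ z, z ∉ X → g z = z) : g • Y = Y := by
  apply Finset.eq_of_subset_of_card_le _ (by rw [Finset.card_smul_finset])
  intro y hy
  rw [mem_sm'] at hy
  by_contra hc
  have h1 := hf y (fun h' => hc (h h'))
  rw [← Equiv.Perm.eq_inv_iff_eq] at h1
  rw [← h1] at hy
  exact hc hy

theorem inv_stab {Y : Finset Ω} {g : Equiv.Perm Ω} (h : g • Y = Y) : g⁻¹ • Y = Y := by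
  rw [inv_smul_eq_iff, h]

/-- `Y` is a minimal enlargement of the Jordan set `X`, by `e` points. -/
structure Step (G : Subgroup (Equiv.Perm Ω)) (X Y : Finset Ω) (e : ℕ) : Prop where
  jx : JS G X
  jy : JS G Y
  sub : X ⊆ Y
  card : Y.card = X.card + e
  pos : 0 < e
  lt : X.Nonempty → e < X.card
  sep : ∀ g ∈ G, g • X = X ∨ Disjoint (g • X) X ∨ e ≤ (X \ g • X).card

theorem Step.sep2 {X Y : Finset Ω} {e : ℕ} (s : Step G X Y e) {g h : Equiv.Perm Ω}
    (hg : g ∈ G) (hh : h ∈ G) (hne : g • X ≠ h • X) (hd : ¬ Disjoint (g • X) (h • X)) :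
    e ≤ (g • X \ h • X).card := by
  have e1 : h • X = g • ((g⁻¹ * h) • X) := by rw [smul_smul]; simp
  rw [e1] at hne hd ⊢
  rw [disj_sm] at hd
  rw [← Finset.smul_finset_sdiff, Finset.card_smul_finset]
  rcases s.sep (g⁻¹ * h) (G.mul_mem (G.inv_mem hg) hh) with h1 | h1 | h1
  · exact absurd (by rw [h1]) hne
  · exact absurd h1.symm hd
  · exact h1

theorem Step.cardE {X Y : Finset Ω} {e : ℕ} (s : Step G X Y e) : (Y \ X).card = e := by
  rw [Finset.card_sdiff_of_subset s.sub, s.card]; omega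

/-- Blocks. -/
def Blk (G : Subgroup (Equiv.Perm Ω)) (X Y B : Finset Ω) : Prop :=
  ∃ g ∈ G, g • Y = Y ∧ B = g • (Y \ X)

theorem Blk.smul {X Y B : Finset Ω} (hB : Blk G X Y B) {k : Equiv.Perm Ω} (hk : k ∈ G)
    (hY : k • Y = Y) : Blk G X Y (k • B) := by
  obtain ⟨g, hg, h1, rfl⟩ := hB
  exact ⟨k * g, G.mul_mem hk hg, by rw [mul_smul, h1, hY], by rw [mul_smul]⟩

theorem Blk.sub {X Y B : Finset Ω} (hB : Blk G X Y B) : B ⊆ Y := by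
  obtain ⟨g, hg, h1, rfl⟩ := hB
  nth_rw 2 [← h1]
  exact Finset.smul_finset_subset_smul_finset Finset.sdiff_subset

theorem Step.blk_card {X Y B : Finset Ω} {e : ℕ} (s : Step G X Y e) (hB : Blk G X Y B) :
    B.card = e := by
  obtain ⟨g, hg, h1, rfl⟩ := hB
  rw [Finset.card_smul_finset, s.cardE]

theorem Step.blk_self (X Y : Finset Ω) : Blk G X Y (Y \ X) :=
  ⟨1, G.one_mem, by simp, by simp⟩

theorem Step.blk_eq0 {X Y : Finset Ω} {e : ℕ} (s : Step G X Y e) {u : Equiv.Perm Ω}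
    (hu : u ∈ G) (hY : u • Y = Y) (hd : ¬ Disjoint (u • (Y \ X)) (Y \ X)) :
    u • (Y \ X) = Y \ X := by
  have hsub : u • X ⊆ Y := by
    have := Finset.smul_finset_subset_smul_finset (a := u) s.sub
    rwa [hY] at this
  rw [Finset.smul_finset_sdiff, hY] at hd ⊢
  rcases s.sep u hu with h | h | h
  · rw [h]
  · rcases X.eq_empty_or_nonempty with rfl | hne
    · simp
    · exfalso
      have h1 := Finset.card_le_card (Finset.union_subset hsub s.sub)
      rw [Finset.card_union_of_disjoint h, Finset.card_smul_finset, s.card] at h1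
      have := s.lt hne
      omega
  · exfalso
    apply hd
    have h1 : (X ∪ u • X).card = Y.card := by
      apply le_antisymm (Finset.card_le_card (Finset.union_subset s.sub hsub))
      rw [s.card]
      have h2 := Finset.card_sdiff_add_card X (u • X)
      rw [Finset.card_smul_finset] at h2
      omega
    have h2 := Finset.eq_of_subset_of_card_le (Finset.union_subset s.sub hsub) h1.ge
    rw [Finset.disjoint_left]
    intro a ha hb
    simp only [Finset.mem_sdiff] at ha hb
    have := ha.1
    rw [← h2, Finset.mem_union] at this
    tauto

theorem Step.blk_eq {X Y B C : Finset Ω} {e : ℕ} (s : Step G X Y e) (hB : Blk G X Y B)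
    (hC : Blk G X Y C) {c : Ω} (h1 : c ∈ B) (h2 : c ∈ C) : B = C := by
  obtain ⟨g, hg, hgY, rfl⟩ := hB
  obtain ⟨k, hk, hkY, rfl⟩ := hC
  have := s.blk_eq0 (u := k⁻¹ * g) (G.mul_mem (G.inv_mem hk) hg)
    (by rw [mul_smul, hgY, inv_stab hkY]) (by
      rw [← disj_sm (g := k), smul_smul, mul_inv_cancel_left, Finset.not_disjoint_iff]
      exact ⟨c, h1, h2⟩)
  rw [mul_smul, inv_smul_eq_iff] at this
  exact this

theorem Step.blk_ex {X Y : Finset Ω} {e : ℕ} (s : Step G X Y e) {y : Ω} (hy : y ∈ Y) :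
    ∃ B, Blk G X Y B ∧ y ∈ B := by
  have : (Y \ X).Nonempty := by rw [← Finset.card_pos, s.cardE]; exact s.pos
  obtain ⟨a, ha⟩ := this
  obtain ⟨g, hg, hf, e⟩ := s.jy a (Finset.mem_sdiff.1 ha).1 y hy
  refine ⟨g • (Y \ X), ⟨g, hg, stab_of_fix (le_refl _) hf, rfl⟩, ?_⟩
  rw [← e, mem_sm]; exact ha

theorem Step.core {X Y B Z : Finset Ω} {e : ℕ} (s : Step G X Y e) (hB : Blk G X Y B)
    (hZ : JS G Z) (hZY : Z ⊆ Y) (hc : Z.Nonempty → e < Z.card) {b : Ω} (hb : b ∈ B)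
    (hbZ : b ∉ Z) : Disjoint B Z := by
  by_contra hd
  rw [Finset.not_disjoint_iff] at hd
  obtain ⟨x, hxB, hxZ⟩ := hd
  have : Z ⊆ B := by
    intro y hy
    obtain ⟨k, hk, hf, rfl⟩ := hZ x hxZ y hy
    have h1 : k • B = B := by
      apply s.blk_eq (hB.smul hk (stab_of_fix hZY hf)) hB (c := b) _ hb
      rw [← hf b hbZ, mem_sm]; exact hb
    rw [← h1, mem_sm]; exact hxB
  have h1 := Finset.card_le_card this
  rw [s.blk_card hB] at h1
  have := hc ⟨x, hxZ⟩
  omega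

theorem Step.two {X Y S : Finset Ω} {e : ℕ} (s : Step G X Y e) (hS : S ⊆ Y)
    (h : ∀ B, Blk G X Y B → ¬ Disjoint B S → B ⊆ S) (hne : S.Nonempty) :
    e ≤ S.card ∧ (e < S.card → 2 * e ≤ S.card) := by
  obtain ⟨a, ha⟩ := hne
  obtain ⟨B, hB, haB⟩ := s.blk_ex (hS ha)
  have hBS := h B hB (Finset.not_disjoint_iff.2 ⟨a, haB, ha⟩)
  have h1 := Finset.card_le_card hBS
  rw [s.blk_card hB] at h1
  refine ⟨h1, fun hlt => ?_⟩
  have : ∃ c ∈ S, c ∉ B := by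
    by_contra hc
    push Not at hc
    have := Finset.card_le_card (show S ⊆ B from hc)
    rw [s.blk_card hB] at this
    omega
  obtain ⟨c, hc, hcB⟩ := this
  obtain ⟨C, hC, hcC⟩ := s.blk_ex (hS hc)
  have hCS := h C hC (Finset.not_disjoint_iff.2 ⟨c, hcC, hc⟩)
  have hd : Disjoint B C := by
    rw [Finset.disjoint_left]
    intro x hx hx'
    rw [s.blk_eq hB hC hx hx'] at hcB
    exact hcB hcC
  have h2 := Finset.card_le_card (Finset.union_subset hBS hCS)
  rw [Finset.card_union_of_disjoint hd, s.blk_card hB, s.blk_card hC] at h2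
  omega

theorem Step.blk_sub_X {X Y B : Finset Ω} {e : ℕ} (s : Step G X Y e) (hB : Blk G X Y B)
    (h : ¬ Disjoint B X) : B ⊆ X := by
  obtain ⟨x, hxB, hxX⟩ := Finset.not_disjoint_iff.1 h
  intro y hy
  by_contra hyX
  have := s.blk_eq hB (Step.blk_self X Y) hy (Finset.mem_sdiff.2 ⟨hB.sub hy, hyX⟩)
  rw [this] at hxB
  exact (Finset.mem_sdiff.1 hxB).2 hxX

theorem Step.lt2 {X Y W : Finset Ω} {e f : ℕ} (s : Step G X Y e) (s' : Step G Y W f)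
    (hne : X.Nonempty) : f < X.card := by
  by_contra hc
  push Not at hc
  have hY : Y.Nonempty := hne.mono s.sub
  have h1 := (s'.two s'.sub (fun B hB h => s'.blk_sub_X hB h) hY).2 (s'.lt hY)
  have := s.card
  have := s.lt hne
  omega

/-- blocks of the second step meeting `Y \ X` lie in it -/
theorem Step.blk_sub_E {X Y W B : Finset Ω} {e f : ℕ} (s : Step G X Y e) (s' : Step G Y W f)
    (hB : Blk G Y W B) {b : Ω} (hb : b ∈ B) (hbE : b ∈ Y \ X) : B ⊆ Y \ X := by
  have h1 := s'.blk_sub_X hB (Finset.not_disjoint_iff.2 ⟨b, hb, (Finset.mem_sdiff.1 hbE).1⟩)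
  have h2 := s'.core hB s.jx (s.sub.trans s'.sub) (s.lt2 s') hb (Finset.mem_sdiff.1 hbE).2
  intro x hx
  exact Finset.mem_sdiff.2 ⟨h1 hx, Finset.disjoint_left.1 h2 hx⟩

theorem Step.le2 {X Y W : Finset Ω} {e f : ℕ} (s : Step G X Y e) (s' : Step G Y W f) :
    f ≤ e ∧ (f < e → 2 * f ≤ e) := by
  have := s'.two (S := Y \ X) (Finset.sdiff_subset.trans s'.sub) (fun B hB h => by
    obtain ⟨x, hxB, hxX⟩ := Finset.not_disjoint_iff.1 h
    exact s.blk_sub_E s' hB hxB hxX) (by rw [← Finset.card_pos, s.cardE]; exact s.pos)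
  rwa [s.cardE] at this

theorem Step.half {X Y W V : Finset Ω} {e d f : ℕ} (s : Step G X Y e) (s' : Step G Y W d)
    (s'' : Step G W V f) (hfd : f < d) : 2 * d ≤ e := by
  obtain ⟨h1, h2⟩ := s.le2 s'
  rcases h1.lt_or_eq with h | h
  · exact h2 h
  exfalso
  subst h
  have hYne : Y.Nonempty := by
    rw [← Finset.card_pos, s.card]; have := s.pos; omega
  have hXne : X.Nonempty := by
    rw [Finset.nonempty_iff_ne_empty]
    rintro rfl
    have h3 := s'.lt hYne
    have := s.card
    simp at this
    omega
  have hEne : (Y \ X).Nonempty := by rw [← Finset.card_pos, s.cardE]; exact s.pos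
  have hFne : (W \ Y).Nonempty := by rw [← Finset.card_pos, s'.cardE]; exact s'.pos
  obtain ⟨a, ha⟩ := hEne
  obtain ⟨b, hb⟩ := hFne
  have haY := (Finset.mem_sdiff.1 ha).1
  have haX := (Finset.mem_sdiff.1 ha).2
  have hbW := (Finset.mem_sdiff.1 hb).1
  have hbY := (Finset.mem_sdiff.1 hb).2
  have hbX : b ∉ X := fun h => hbY (s.sub h)
  have haV : a ∈ V := s''.sub (s'.sub haY)
  have hXV : X ⊆ V := (s.sub.trans s'.sub).trans s''.sub
  have hXd := s.lt2 s' hXne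
  obtain ⟨A, hA, haA⟩ := s''.blk_ex haV
  have hAX : Disjoint A X := s''.core hA s.jx hXV (fun _ => by omega) haA haX
  have hbA : b ∉ A := by
    intro hbA
    have := s''.core hA s'.jx (s'.sub.trans s''.sub) (fun _ => by have := s'.lt hYne; omega) hbA hbY
    exact Finset.disjoint_left.1 this haA haY
  obtain ⟨u, hu, huV, rfl⟩ := hA
  have huW : ∀ x, x ∈ u • W ↔ x ∈ V ∧ x ∉ u • (V \ W) := by
    intro x
    have hx : x ∈ V ↔ u⁻¹ x ∈ V := by rw [← mem_sm', huV]
    rw [mem_sm', mem_sm', Finset.mem_sdiff, ← hx]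
    constructor
    · intro h
      exact ⟨hx.2 (s''.sub h), fun h' => h'.2 h⟩
    · intro h
      by_contra hc
      exact h.2 ⟨h.1, hc⟩
  have hXuW : u⁻¹ • X ⊆ W := by
    rw [← Finset.subset_smul_finset_iff]
    intro x hx
    exact (huW x).2 ⟨hXV hx, fun h => Finset.disjoint_left.1 hAX h hx⟩
  have hbuW : u⁻¹ b ∈ W := by rw [← mem_sm']; exact (huW b).2 ⟨s''.sub hbW, hbA⟩
  obtain ⟨B, hB, hbB⟩ := s'.blk_ex hbuW
  have hBX := s'.core hB (s.jx.smul (G.inv_mem hu)) hXuW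
    (fun _ => by rw [Finset.card_smul_finset]; exact hXd) hbB (by rw [mem_sm']; simpa using hbX)
  obtain ⟨g, hg, hgW, rfl⟩ := hB
  have hgY : ∀ x, x ∈ g • Y ↔ x ∈ W ∧ x ∉ g • (W \ Y) := by
    intro x
    have hx : x ∈ W ↔ g⁻¹ x ∈ W := by rw [← mem_sm', hgW]
    rw [mem_sm', mem_sm', Finset.mem_sdiff, ← hx]
    constructor
    · intro h
      exact ⟨hx.2 (s'.sub h), fun h' => h'.2 h⟩
    · intro h
      by_contra hc
      exact h.2 ⟨h.1, hc⟩
  have hXY' : X ⊆ (u * g) • Y := by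
    rw [mul_smul, Finset.subset_smul_finset_iff]
    intro x hx
    exact (hgY x).2 ⟨hXuW hx, fun h => Finset.disjoint_left.1 hBX h hx⟩
  have haY' : a ∉ (u * g) • Y := by
    intro h
    rw [mul_smul, mem_sm'] at h
    have := ((hgY _).1 h).1
    rw [← mem_sm'] at this
    exact ((huW a).1 this).2 haA
  have hbY' : b ∉ (u * g) • Y := by
    intro h
    rw [mul_smul, mem_sm'] at h
    exact ((hgY _).1 h).2 hbB
  have hY'V : (u * g) • Y ⊆ V := by
    intro x h
    rw [mul_smul, mem_sm'] at h
    have := ((hgY _).1 h).1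
    rw [← mem_sm'] at this
    exact ((huW x).1 this).1
  have hug : u * g ∈ G := G.mul_mem hu hg
  obtain ⟨x0, hx0⟩ := hXne
  have key : ∀ p ∈ G, X ⊆ p • Y → p • Y ≠ (u * g) • Y →
      ∀ z ∈ p • Y, z ∈ (u * g) • Y → z ∈ X := by
    intro p hp hXp hne z hz hz'
    by_contra hzX
    have h3 := s'.sep2 hp hug hne (Finset.not_disjoint_iff.2 ⟨x0, hXp hx0, hXY' hx0⟩)
    have h4 : p • Y \ (u * g) • Y ⊆ (p • Y \ X).erase z := by
      intro w hw
      rw [Finset.mem_sdiff] at hw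
      rw [Finset.mem_erase, Finset.mem_sdiff]
      refine ⟨?_, hw.1, fun h => hw.2 (hXY' h)⟩
      rintro rfl
      exact hw.2 hz'
    have h5 := Finset.card_le_card h4
    rw [Finset.card_erase_of_mem (Finset.mem_sdiff.2 ⟨hz, hzX⟩),
      Finset.card_sdiff_of_subset hXp, Finset.card_smul_finset, s.card] at h5
    have := s.pos
    omega
  have k1 : ∀ z ∈ Y, z ∈ (u * g) • Y → z ∈ X := by
    have := key 1 G.one_mem (by simpa using s.sub) (by
      rw [one_smul]; intro h; exact haY' (h ▸ haY))
    simpa using this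
  have k2 : ∀ z ∈ W, z ∉ Y → z ∉ (u * g) • Y := by
    obtain ⟨C, hC, haC⟩ := s'.blk_ex (s'.sub haY)
    have hCE : C = Y \ X := by
      apply Finset.eq_of_subset_of_card_le (s.blk_sub_E s' hC haC ha)
      rw [s.cardE, s'.blk_card hC]
    obtain ⟨p, hp, hpW, rfl⟩ := hC
    have hpY : ∀ x, x ∈ W → x ∉ Y \ X → x ∈ p • Y := by
      intro x hx hx'
      rw [← hCE, mem_sm', Finset.mem_sdiff] at hx'
      rw [mem_sm']
      by_contra hc
      exact hx' ⟨by rw [← mem_sm', hpW]; exact hx, hc⟩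
    intro z hzW hzY hz
    refine hzY (s.sub (key p hp ?_ ?_ z ?_ hz))
    · intro x hx
      exact hpY x (s'.sub (s.sub hx)) (fun h => (Finset.mem_sdiff.1 h).2 hx)
    · intro h
      apply hbY'
      rw [← h]
      exact hpY b hbW (fun h => hbY (Finset.mem_sdiff.1 h).1)
    · exact hpY z hzW (fun h => hzY (Finset.mem_sdiff.1 h).1)
  have h6 : (u * g) • Y ⊆ X ∪ (V \ W) := by
    intro z hz
    rw [Finset.mem_union, Finset.mem_sdiff]
    by_cases hzY : z ∈ Y
    · exact Or.inl (k1 z hzY hz)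
    · exact Or.inr ⟨hY'V hz, fun h => k2 z h hzY hz⟩
  have h7 := (Finset.card_le_card h6).trans (Finset.card_union_le _ _)
  rw [Finset.card_smul_finset, s.card, s''.cardE] at h7
  omega

theorem mem_sm_sdiff {Y W : Finset Ω} (h : Y ⊆ W) {g : Equiv.Perm Ω} (x : Ω) :
    x ∈ g • Y ↔ x ∈ g • W ∧ x ∉ g • (W \ Y) := by
  rw [mem_sm', mem_sm', mem_sm', Finset.mem_sdiff]
  have := @h (g⁻¹ x)
  tauto

theorem Step.lines {Y W : Finset Ω} {d : ℕ} (s : Step G Y W d) (hY : Y.Nonempty)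
    {p q : Equiv.Perm Ω} (hp : p ∈ G) (hq : q ∈ G) (hne : p • Y ≠ q • Y)
    (h : Wᶜ.card ≤ ((p • Y)ᶜ ∩ (q • Y)ᶜ).card) :
    ((p • Y)ᶜ ∩ (q • Y)ᶜ).card ≤ Wᶜ.card := by
  have hW := Finset.card_compl_add_card W
  have h1 : ((q • Y)ᶜ).card + Y.card = Fintype.card Ω := by
    have := Finset.card_compl_add_card (q • Y)
    rwa [Finset.card_smul_finset] at this
  have h2 : (p • Y \ q • Y).card + ((p • Y)ᶜ ∩ (q • Y)ᶜ).card = ((q • Y)ᶜ).card := by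
    have h3 : p • Y \ q • Y = (q • Y)ᶜ \ (p • Y)ᶜ := by
      ext x; simp only [Finset.mem_sdiff, Finset.mem_compl]; tauto
    rw [h3, Finset.inter_comm, Finset.card_sdiff_add_card_inter]
  have h4 := s.card
  have h5 := s.lt hY
  by_cases hd : Disjoint (p • Y) (q • Y)
  · exfalso
    rw [Finset.sdiff_eq_self_of_disjoint hd, Finset.card_smul_finset] at h2
    omega
  · have := s.sep2 hp hq hne hd
    omega

theorem Step.tits {X Y W : Finset Ω} {e d : ℕ} (s : Step G X Y e) (s' : Step G Y W d)
    (hall : ∀ S : Finset Ω, S.card = W.card → ∃ g ∈ G, S = g • W) (hd : 2 ≤ d) :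
    d + Wᶜ.card ≤ e := by
  have hEne : (Y \ X).Nonempty := by rw [← Finset.card_pos, s.cardE]; exact s.pos
  have hFne : (W \ Y).Nonempty := by rw [← Finset.card_pos, s'.cardE]; exact s'.pos
  obtain ⟨y, hy⟩ := hEne
  obtain ⟨x0, hx0⟩ := hFne
  have hyY := (Finset.mem_sdiff.1 hy).1
  have hyX := (Finset.mem_sdiff.1 hy).2
  have hYne : Y.Nonempty := ⟨y, hyY⟩
  obtain ⟨S, hS⟩ : ∃ S, S = insert x0 Wᶜ := ⟨_, rfl⟩
  have hx0W : x0 ∉ Wᶜ := by simpa using (Finset.mem_sdiff.1 hx0).1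
  have hScard : S.card = Wᶜ.card + 1 := by rw [hS, Finset.card_insert_of_notMem hx0W]
  have hSY : ∀ x ∈ S, x ∉ Y := by
    intro x hx hxY
    rw [hS, Finset.mem_insert, Finset.mem_compl] at hx
    rcases hx with rfl | hx
    · exact (Finset.mem_sdiff.1 hx0).2 hxY
    · exact hx (s'.sub hxY)
  have main : ∀ z, ∃ B : Finset Ω, z ∈ S → B ⊆ Y \ X ∧ y ∈ B ∧ B.card = d ∧
      ∃ p ∈ G, (p • Y)ᶜ = S.erase z ∪ B := by
    intro z
    by_cases hz : z ∈ S
    swap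
    · exact ⟨∅, fun h => absurd h hz⟩
    have hec : (S.erase z).card = Wᶜ.card := by rw [Finset.card_erase_of_mem hz, hScard]; rfl
    obtain ⟨u, hu, huW⟩ := hall (S.erase z)ᶜ (by
      have h1 := Finset.card_compl_add_card W
      have h2 := Finset.card_compl_add_card (S.erase z)
      omega)
    have hYW : Y ⊆ u • W := by
      intro x hx
      rw [← huW, Finset.mem_compl]
      intro h
      exact hSY x (Finset.mem_of_mem_erase h) hx
    have hXuW : u⁻¹ • X ⊆ W := by
      rw [← Finset.subset_smul_finset_iff]
      exact s.sub.trans hYW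
    obtain ⟨B, hB, hyB⟩ := s'.blk_ex (y := u⁻¹ y) (by rw [← mem_sm']; exact hYW hyY)
    have hBX := s'.core hB (s.jx.smul (G.inv_mem hu)) hXuW
      (fun h => by
        rw [Finset.card_smul_finset]; exact s.lt2 s' (by simpa using h)) hyB
        (by rw [mem_sm']; simpa using hyX)
    have hBc := s'.blk_card hB
    obtain ⟨g, hg, hgW, rfl⟩ := hB
    have hpY : ((u * g) • Y)ᶜ = S.erase z ∪ u • g • (W \ Y) := by
      ext x
      have := mem_sm_sdiff s'.sub (g := u * g) x
      rw [mul_smul, mul_smul, mul_smul, hgW, ← huW, Finset.mem_compl] at this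
      rw [Finset.mem_compl, Finset.mem_union, mul_smul]
      tauto
    have hug := G.mul_mem hu hg
    have hyp : y ∉ (u * g) • Y := by
      rw [← Finset.mem_compl, hpY, Finset.mem_union, mem_sm' (g := u)]
      exact Or.inr hyB
    have hsub : S.erase z ⊆ ((1 : Equiv.Perm Ω) • Y)ᶜ ∩ ((u * g) • Y)ᶜ := by
      intro x hx
      rw [hpY, Finset.mem_inter, Finset.mem_compl, one_smul, Finset.mem_union]
      exact ⟨hSY x (Finset.mem_of_mem_erase hx), Or.inl hx⟩
    have hl := s'.lines hYne G.one_mem hug (by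
      rw [one_smul]; intro h; rw [← h] at hyp; exact hyp hyY) (by
      rw [← hec]; exact Finset.card_le_card hsub)
    have heq := Finset.eq_of_subset_of_card_le hsub (by rw [hec]; exact hl)
    refine ⟨u • g • (W \ Y), fun _ => ⟨?_, ?_, ?_, u * g, hug, hpY⟩⟩
    · intro x hx
      rw [Finset.mem_sdiff]
      constructor
      · by_contra hxY
        have h1 : x ∈ S.erase z := by
          rw [heq, hpY, Finset.mem_inter, Finset.mem_compl, one_smul, Finset.mem_union]
          exact ⟨hxY, Or.inr hx⟩
        have h2 : x ∈ u • W := by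
          rw [mem_sm'] at hx ⊢
          rw [← hgW]
          exact Finset.smul_finset_subset_smul_finset Finset.sdiff_subset hx
        rw [← huW, Finset.mem_compl] at h2
        exact h2 h1
      · intro hxX
        rw [mem_sm'] at hx
        refine Finset.disjoint_left.1 hBX hx ?_
        exact mem_sm.2 hxX
    · rw [mem_sm']; exact hyB
    · rw [Finset.card_smul_finset]; exact hBc
  choose B hB using main
  have hpair : (S : Set Ω).PairwiseDisjoint (fun z => (B z).erase y) := by
    intro z hz w hw hzw
    obtain ⟨hz1, hz2, hz3, p, hp, hpY⟩ := hB z hz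
    obtain ⟨hw1, hw2, hw3, q, hq, hqY⟩ := hB w hw
    change Disjoint ((B z).erase y) ((B w).erase y)
    rw [Finset.disjoint_left]
    intro x hx hx'
    have hz' : z ∈ S := hz
    have hw' : w ∈ S := hw
    rw [Finset.mem_erase] at hx hx'
    have hyS : y ∉ (S.erase z).erase w := fun h =>
      hSY y (Finset.mem_of_mem_erase (Finset.mem_of_mem_erase h)) hyY
    have hxS : x ∉ insert y ((S.erase z).erase w) := by
      rw [Finset.mem_insert]
      rintro (h | h)
      · exact hx.1 h
      · exact hSY x (Finset.mem_of_mem_erase (Finset.mem_of_mem_erase h))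
          (Finset.mem_sdiff.1 (hz1 hx.2)).1
    have hsub : insert x (insert y ((S.erase z).erase w)) ⊆ (p • Y)ᶜ ∩ (q • Y)ᶜ := by
      intro v hv
      rw [hpY, hqY]
      simp only [Finset.mem_inter, Finset.mem_union, Finset.mem_insert, Finset.mem_erase] at hv ⊢
      rcases hv with rfl | rfl | hv
      · tauto
      · tauto
      · tauto
    have hc := Finset.card_le_card hsub
    have h2 : ((S.erase z).erase w).card + 1 = Wᶜ.card := by
      rw [Finset.card_erase_of_mem (Finset.mem_erase.2 ⟨hzw.symm, hw'⟩),
        Finset.card_erase_of_mem hz', hScard]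
      have : 1 < S.card := Finset.one_lt_card.2 ⟨z, hz', w, hw', hzw⟩
      omega
    rw [Finset.card_insert_of_notMem hxS, Finset.card_insert_of_notMem hyS] at hc
    have hl := s'.lines hYne hp hq (by
      intro h
      rw [← h, hpY] at hqY
      have : w ∈ S.erase w ∪ B w := by
        rw [← hqY]; exact Finset.mem_union_left _ (Finset.mem_erase.2 ⟨hzw.symm, hw'⟩)
      rw [Finset.mem_union] at this
      rcases this with h | h
      · simp at h
      · exact hSY w hw' (Finset.mem_sdiff.1 (hw1 h)).1) (by omega)
    omega
  have hbig : S.biUnion (fun z => (B z).erase y) ⊆ (Y \ X).erase y := by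
    intro x hx
    rw [Finset.mem_biUnion] at hx
    obtain ⟨z, hz, hx⟩ := hx
    exact Finset.erase_subset_erase y (hB z hz).1 hx
  have hcard := Finset.card_le_card hbig
  rw [Finset.card_biUnion hpair, Finset.card_erase_of_mem hy, s.cardE,
    Finset.sum_congr rfl (fun z hz => by
      rw [Finset.card_erase_of_mem (hB z hz).2.1, (hB z hz).2.2.1]),
    Finset.sum_const, hScard, smul_eq_mul] at hcard
  have := s.pos
  obtain ⟨d', rfl⟩ : ∃ d', d = d' + 2 := ⟨d - 2, by omega⟩
  obtain ⟨e', rfl⟩ : ∃ e', e = e' + 1 := ⟨e - 1, by omega⟩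
  simp only [Nat.add_sub_cancel] at hcard
  have h3 : d' + 2 - 1 = d' + 1 := by omega
  rw [h3] at hcard
  nlinarith

theorem prim_fin (h : isPrimitiveSub G) (B : Finset Ω)
    (hB : ∀ g ∈ G, g • B = B ∨ Disjoint (g • B) B) : B.card ≤ 1 ∨ B = Finset.univ := by
  have key : ∀ g : Equiv.Perm Ω, (fun ω => g ω) '' (B : Set Ω) = ((g • B : Finset Ω) : Set Ω) := by
    intro g
    rw [Finset.coe_smul_finset]
    rfl
  rcases h.2 (B : Set Ω) (fun g hg => by
    rw [key, Finset.coe_inj, Finset.disjoint_coe]; exact hB g hg) with h1 | h1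
  · left
    rw [Finset.card_le_one]
    intro a ha b hb
    exact h1 ha hb
  · right
    rw [← Finset.coe_univ, Finset.coe_inj] at h1
    exact h1

theorem exists_step (h : isPrimitiveSub G) {X : Finset Ω} (hX : JS G X) (h2 : 1 < X.card)
    (hu : X ≠ Finset.univ) : ∃ Y e, Step G X Y e := by
  classical
  have hex : ∃ e, ∃ g ∈ G, g • X ≠ X ∧ ¬ Disjoint (g • X) X ∧ (X \ g • X).card = e := by
    by_contra hc
    push Not at hc
    rcases prim_fin h X (fun g hg => by
      by_contra hcc
      push Not at hcc
      exact hc _ g hg hcc.1 hcc.2 rfl) with h1 | h1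
    · omega
    · exact hu h1
  obtain ⟨g, hg, hne, hd, hc⟩ := Nat.find_spec hex
  have hmin := fun m => Nat.find_min' hex (m := m)
  generalize Nat.find hex = e at *
  have hi := Finset.card_sdiff_add_card_inter X (g • X)
  have hu := Finset.card_sdiff_add_card X (g • X)
  rw [Finset.card_smul_finset] at hu
  refine ⟨X ∪ g • X, e, hX, hX.union (hX.smul hg) (fun h => hd h.symm), Finset.subset_union_left,
    by omega, ?_, ?_, ?_⟩
  · rw [← hc, Finset.card_pos, Finset.sdiff_nonempty]
    intro hs
    exact hne (Finset.eq_of_subset_of_card_le hs (by rw [Finset.card_smul_finset])).symm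
  · intro _
    have : 0 < (X ∩ g • X).card := by
      rw [Finset.card_pos, Finset.nonempty_iff_ne_empty]
      intro h
      exact hd (Finset.disjoint_iff_inter_eq_empty.2 (by rw [Finset.inter_comm]; exact h))
    omega
  · intro k hk
    by_contra hcc
    push Not at hcc
    have := hmin _ ⟨k, hk, hcc.1, hcc.2.1, rfl⟩
    omega

/-- All sets of the size of `X` are translates of `X`. -/
def Homog (G : Subgroup (Equiv.Perm Ω)) (X : Finset Ω) : Prop :=
  ∀ S : Finset Ω, S.card = X.card → ∃ g ∈ G, S = g • X

theorem homog_univ : Homog G (Finset.univ : Finset Ω) := by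
  intro S hS
  refine ⟨1, G.one_mem, ?_⟩
  rw [one_smul]
  exact (Finset.card_eq_iff_eq_univ S).1 hS

theorem Step.homog {Y W : Finset Ω} (s : Step G Y W 1) (hW : Homog G W) : Homog G Y := by
  intro S hS
  have hSn : S.card < Fintype.card Ω := by
    have := s.card
    have := Finset.card_le_univ W
    omega
  obtain ⟨v, hv⟩ : ∃ v, v ∉ S := by
    by_contra hc
    push Not at hc
    rw [← Finset.eq_univ_iff_forall] at hc
    rw [hc, Finset.card_univ] at hSn
    omega
  obtain ⟨h, hh, heq⟩ := hW (insert v S) (by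
    rw [Finset.card_insert_of_notMem hv, s.card, hS])
  obtain ⟨B, hB, hvB⟩ := s.blk_ex (y := h⁻¹ v) (by rw [← mem_sm', ← heq]; simp)
  have hBc := s.blk_card hB
  obtain ⟨g, hg, hgW, rfl⟩ := hB
  refine ⟨h * g, G.mul_mem hh hg, ?_⟩
  symm
  apply Finset.eq_of_subset_of_card_le
  · intro x hx
    rw [mem_sm_sdiff s.sub, mul_smul, mul_smul, hgW, ← heq, Finset.mem_insert] at hx
    rcases hx.1 with rfl | h1
    · exact absurd (mem_sm'.2 hvB) hx.2
    · exact h1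
  · rw [Finset.card_smul_finset, hS]

theorem Step.univ (h : isPrimitiveSub G) {W : Finset Ω} {f : ℕ} (s : Step G W Finset.univ f)
    (hW : W.Nonempty) : f = 1 := by
  rcases prim_fin h (Finset.univ \ W) (fun g hg => by
    by_contra hc
    push Not at hc
    exact hc.1 (s.blk_eq0 hg Finset.smul_finset_univ hc.2)) with h1 | h1
  · rw [s.cardE] at h1
    have := s.pos
    omega
  · obtain ⟨w, hw⟩ := hW
    have : w ∈ Finset.univ \ W := by rw [h1]; simp
    simp [hw] at this

theorem dicho (h : isPrimitiveSub G) (N : ℕ) : ∀ Y : Finset Ω, Yᶜ.card = N → JS G Y →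
    1 < Y.card → Homog G Y ∨ ∀ X e, Step G X Y e → Yᶜ.card ≤ e := by
  induction N using Nat.strong_induction_on with
  | _ N ih =>
    intro Y hN hJ h1
    by_cases hu : Y = Finset.univ
    · left; rw [hu]; exact homog_univ
    obtain ⟨W, d, s'⟩ := exists_step h hJ h1 hu
    have hYW := Finset.card_compl_add_card Y
    have hWW := Finset.card_compl_add_card W
    have hc := s'.card
    have hp := s'.pos
    have hcomp : Yᶜ.card = d + Wᶜ.card := by omega
    have IH := ih Wᶜ.card (by omega) W rfl s'.jy (by omega)
    by_cases hH : Homog G W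
    · by_cases hd : d = 1
      · subst hd
        left; exact s'.homog hH
      · right
        intro X e s
        rw [hcomp]
        exact s.tits s' hH (by omega)
    · have IH := (IH.resolve_left hH) Y d s'
      right
      intro X e s
      obtain ⟨V, f, s''⟩ := exists_step h s'.jy (by omega) (fun hW => hH (hW ▸ homog_univ))
      have hVV := Finset.card_compl_add_card V
      have hVc := s''.card
      have hVu : V ≠ Finset.univ := by
        rintro rfl
        have := s''.univ h (Finset.card_pos.1 (by omega))
        subst this
        exact hH (s''.homog homog_univ)
      have hVp : 0 < Vᶜ.card := by
        rw [Finset.card_pos, Finset.nonempty_iff_ne_empty, Ne, Finset.compl_eq_empty_iff]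
        exact hVu
      have := s.half s' s'' (by omega)
      omega

theorem comm_threeCycle {g h : Equiv.Perm Ω} {a : Ω} (hg : g a ≠ a) (hh : h a ≠ a)
    (H : ∀ z, z ≠ a → g z = z ∨ h z = z) :
    (g * h * g⁻¹ * h⁻¹).IsThreeCycle := by
  have hbc : g a ≠ h a := by
    intro hE
    rcases H (g a) hg with h1 | h1
    · exact hg (g.injective h1)
    · rw [hE] at h1; exact hh (h.injective h1)
  have key : g * h * g⁻¹ * h⁻¹ = Equiv.swap a (h a) * Equiv.swap a (g a) := by
    rw [mul_inv_eq_iff_eq_mul, mul_inv_eq_iff_eq_mul]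
    ext x
    simp only [Equiv.Perm.mul_apply]
    by_cases hxa : x = a
    · subst hxa
      have : h (g x) = g x := by
        rcases H (g x) hg with h1 | h1
        · exact absurd (g.injective h1) hg
        · exact h1
      have h2 : g (h x) = h x := by
        rcases H (h x) hh with h1 | h1
        · exact h1
        · exact absurd (h.injective h1) hh
      rw [this, h2, Equiv.swap_apply_right, Equiv.swap_apply_left]
    · have hga : g x ≠ g a := fun h' => hxa (g.injective h')
      have hha : h x ≠ h a := fun h' => hxa (h.injective h')
      rcases H x hxa with h1 | h1
      · rw [h1]
        by_cases hx : h x = a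
        · rw [hx, Equiv.swap_apply_left, Equiv.swap_apply_of_ne_of_ne hg hbc]
        · have h3 : g (h x) = h x := by
            rcases H (h x) hx with h2 | h2
            · exact h2
            · rw [h.injective h2, h1]
          rw [h3, Equiv.swap_apply_of_ne_of_ne hx (by
            intro h4; rw [h4] at h3; exact hg (g.injective h3)), Equiv.swap_apply_of_ne_of_ne hx hha]
      · rw [h1]
        by_cases hx : g x = a
        · rw [hx]
          rw [Equiv.swap_apply_of_ne_of_ne hh hbc.symm, Equiv.swap_apply_right]
        · have h3 : h (g x) = g x := by
            rcases H (g x) hx with h2 | h2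
            · rw [g.injective h2, h1]
            · exact h2
          rw [h3, Equiv.swap_apply_of_ne_of_ne hx hga, Equiv.swap_apply_of_ne_of_ne hx (by
            intro h4; rw [h4] at h3; exact hh (h.injective h3))]
  rw [key]
  exact Equiv.Perm.isThreeCycle_swap_mul_swap_same hh.symm hg.symm hbc.symm

theorem JS.move {X : Finset Ω} (hX : JS G X) (h1 : 1 < X.card) {a : Ω} (ha : a ∈ X) :
    ∃ g ∈ G, (∀ z, z ∉ X → g z = z) ∧ g a ≠ a := by
  obtain ⟨b, hb, hba⟩ := Finset.exists_mem_ne h1 a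
  obtain ⟨g, hg, hf, e⟩ := hX a ha b hb
  exact ⟨g, hg, hf, by rw [e]; exact hba⟩

end marg

/-- Marggraff's theorem. -/
theorem stmt17 {Ω : Type*} [Fintype Ω] [DecidableEq Ω] (G : Subgroup (Equiv.Perm Ω))
    (hprim : isPrimitiveSub G) (Γ : Set Ω) (hJ : isJordanSet G Γ)
    (hsmall : 2 * Γ.ncard < Fintype.card Ω) :
    alternatingGroup Ω ≤ G := by
  classical
  obtain ⟨h1, K, hKG, hKf, hKt⟩ := hJ
  obtain ⟨X, rfl⟩ : ∃ X : Finset Ω, Γ = (X : Set Ω) := ⟨Γ.toFinset, by simp⟩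
  rw [Set.ncard_coe_finset] at h1 hsmall
  have hX : JS G X := by
    intro u hu v hv
    obtain ⟨g, hg, e⟩ := hKt u hu v hv
    exact ⟨g, hKG hg, fun z hz => hKf g hg z hz, e⟩
  have s0 : Step G ∅ X X.card :=
    ⟨fun u hu => absurd hu (Finset.notMem_empty u), hX, Finset.empty_subset _, by simp, by omega,
      fun h => absurd h Finset.not_nonempty_empty, fun g _ => Or.inl (by simp)⟩
  have hcc := Finset.card_compl_add_card X
  have hH : Homog G X := by
    rcases dicho hprim _ X rfl hX h1 with h | h
    · exact h
    · have := h ∅ _ s0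
      omega
  obtain ⟨a, ha⟩ : X.Nonempty := Finset.card_pos.1 (by omega)
  obtain ⟨R, hR, hRc⟩ := Finset.exists_subset_card_eq (s := Xᶜ) (n := X.card - 1) (by omega)
  have haR : a ∉ R := fun h => (Finset.mem_compl.1 (hR h)) ha
  have hYc : (insert a R).card = X.card := by rw [Finset.card_insert_of_notMem haR]; omega
  obtain ⟨k, hk, hkX⟩ := hH (insert a R) hYc
  have hY : JS G (insert a R) := by rw [hkX]; exact hX.smul hk
  obtain ⟨g, hg, hgf, hga⟩ := hX.move h1 ha
  obtain ⟨h, hh, hhf, hha⟩ := hY.move (by omega) (Finset.mem_insert_self a R)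
  have h3 := comm_threeCycle hga hha (fun z hz => by
    by_cases hzX : z ∈ X
    · right
      apply hhf
      rw [Finset.mem_insert]
      rintro (h | h)
      · exact hz h
      · exact (Finset.mem_compl.1 (hR h)) hzX
    · left; exact hgf z hzX)
  have hP : MulAction.IsPreprimitive G Ω := by
    have : MulAction.IsPretransitive G Ω := ⟨fun x y => by
      obtain ⟨g, hg, e⟩ := hprim.1 x y
      exact ⟨⟨g, hg⟩, e⟩⟩
    refine ⟨fun {B} hB => ?_⟩
    apply hprim.2 B
    intro g hg
    exact MulAction.isBlock_iff_smul_eq_or_disjoint.1 hB ⟨g, hg⟩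
  exact Equiv.Perm.alternatingGroup_le_of_isPreprimitive_of_isThreeCycle_mem hP h3
    (G.mul_mem (G.mul_mem (G.mul_mem hg hh) (G.inv_mem hg)) (G.inv_mem hh))
end

section
/- For every composite integer rs with r,s > 1, every pair of transitive permutation groups R of degree r and S of degree s, and every odd integer m ≥ 3, there exists a connected G-arc-transitive graph Δ of valency rs with Alt(Ω) ≤ G ≤ Sym(Ω) for a set Ω of size mrs + r − 1, such that for an arc (x,y): G_x^{Δ(x)} is permutation isomorphic to the imprimitive wreath product R ≀ S of degree rs, G_x^{[1]} ≅ R^{s(m−1)} × R_{r−1}, and G_{x,y}^{[1]} ≅ R^{s(m−2)+1}. -/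
open Equiv Subgroup

/-- The imprimitive wreath product `R ≀ S` of degree `rs`, as a set of permutations of
`Fin r × Fin s` (blocks `Fin r × {i}`). -/
def wreathSet {r s : ℕ} (R : Subgroup (Equiv.Perm (Fin r))) (S : Subgroup (Equiv.Perm (Fin s))) :
    Set (Equiv.Perm (Fin r × Fin s)) :=
  {σ | ∃ τ ∈ S, ∃ f : Fin s → Equiv.Perm (Fin r), (∀ i, f i ∈ R) ∧
    ∀ p : Fin r × Fin s, σ p = (f p.2 p.1, τ p.2)}

/-- `G_x^{[1]}`, pulled back through the action `φ` of the group `G` on the vertices. -/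
def ker1 {V : Type*} {P : Type*} [Group P] (Δ : SimpleGraph V) (φ : P →* Equiv.Perm V)
    (x : V) : Subgroup P :=
  Subgroup.comap φ (⨅ v ∈ insert x (Δ.neighborSet x), MulAction.stabilizer (Equiv.Perm V) v)

/-- The coset graph. -/
def cosetG {Q : Type} [Group Q] (H : Subgroup Q) (t : Q) (htt : t * t = 1) (htH : t ∉ H) :
    SimpleGraph (Q ⧸ H) where
  Adj u v := ∃ g : Q, u = (g : Q ⧸ H) ∧ v = ((g * t : Q) : Q ⧸ H)
  symm := ⟨by
    rintro u v ⟨g, rfl, rfl⟩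
    exact ⟨g * t, rfl, by rw [mul_assoc, htt, mul_one]⟩⟩
  loopless := ⟨by
    rintro u ⟨g, rfl, h⟩
    rw [QuotientGroup.eq] at h
    exact htH (by simpa using h)⟩

lemma equiv_of_range {K' L M : Type*} [Group K'] [Group L] [Group M] (ρ : K' →* L)
    (hρ : Function.Injective ρ) (Θ : M →* L) (hΘ : Function.Injective Θ) (K : Subgroup K')
    (h : ∀ x, (∃ y, Θ y = x) ↔ ∃ k ∈ K, ρ k = x) : Nonempty (K ≃* M) := by
  have hE : K.map ρ = Θ.range := by
    ext x
    rw [Subgroup.mem_map, MonoidHom.mem_range, h]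
  exact ⟨((K.equivMapOfInjective ρ hρ).trans (MulEquiv.subgroupCongr hE)).trans
    (MonoidHom.ofInjective hΘ).symm⟩

lemma mem_ker1 {V P : Type*} [Group P] (Δ : SimpleGraph V) (φ : P →* Equiv.Perm V)
    (x : V) (k : P) : k ∈ ker1 Δ φ x ↔ φ k x = x ∧ ∀ v : Δ.neighborSet x, φ k v = v := by
  simp [ker1, Subgroup.mem_iInf, MulAction.mem_stabilizer_iff]

lemma pkg {Q Ω A : Type} [Group Q] [Finite Q] (ρ : Q →* Perm Ω) (hρ : Function.Injective ρ)
    (H : Subgroup Q) (t : Q) (htt : t * t = 1) (htH : t ∉ H)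
    (gen : Subgroup.closure (insert t (H : Set Q)) = ⊤)
    (ι : A → Ω) (hι : Function.Injective ι) (a0 : A)
    (hHι : ∀ h ∈ H, ∀ a, ∃ b, ρ h (ι a) = ι b)
    (htr : ∀ a, ∃ h ∈ H, ρ h (ι a0) = ι a)
    (hst : ∀ h ∈ H, (ρ h (ι a0) = ι a0 ↔ t * h * t ∈ H))
    (hΩ : ∀ ω, ∃ q, ρ q (ι a0) = ω)
    {M1 M2 : Type} [Group M1] [Group M2] (Θ1 : M1 →* Perm Ω) (hΘ1 : Function.Injective Θ1)
    (Θ2 : M2 →* Perm Ω) (hΘ2 : Function.Injective Θ2)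
    (hr1 : ∀ x, (∃ y, Θ1 y = x) ↔ ∃ k : Q, (k ∈ H ∧ ∀ a, ρ k (ι a) = ι a) ∧ ρ k = x)
    (hr2 : ∀ x, (∃ y, Θ2 y = x) ↔ ∃ k : Q, ((k ∈ H ∧ ∀ a, ρ k (ι a) = ι a) ∧
      (t * k * t ∈ H ∧ ∀ a, ρ (t * k * t) (ι a) = ι a)) ∧ ρ k = x) :
    ∃ (V : Type) (_ : Fintype V) (Δ : SimpleGraph V) (φ : Q →* Equiv.Perm V),
      Function.Injective φ ∧
      (∀ (g : Q) (u v : V), Δ.Adj (φ g u) (φ g v) ↔ Δ.Adj u v) ∧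
      Δ.Connected ∧
      (∀ u v u' v' : V, Δ.Adj u v → Δ.Adj u' v' → ∃ g : Q, φ g u = u' ∧ φ g v = v') ∧
      (∀ x : V, (Δ.neighborSet x).ncard = Nat.card A) ∧
      ∀ x y : V, Δ.Adj x y →
        (∃ e : Δ.neighborSet x ≃ A,
          {σ : Equiv.Perm A | ∃ g : Q, φ g x = x ∧
            ∀ v w : Δ.neighborSet x, φ g (v : V) = (w : V) → σ (e v) = e w} =
            {σ | ∃ h ∈ H, ∀ a, ρ h (ι a) = ι (σ a)}) ∧
        Nonempty (ker1 Δ φ x ≃* M1) ∧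
        Nonempty ((ker1 Δ φ x ⊓ ker1 Δ φ y : Subgroup Q) ≃* M2) := by
  classical
  have tinv : t⁻¹ = t := inv_eq_of_mul_eq_one_left htt
  set Δ := cosetG H t htt htH with hΔ
  set φ := MulAction.toPermHom Q (Q ⧸ H) with hφ
  have φa : ∀ g k : Q, φ g (k : Q ⧸ H) = ((g * k : Q) : Q ⧸ H) := fun g k => rfl
  have fixx : ∀ g k : Q, φ k (g : Q ⧸ H) = (g : Q ⧸ H) ↔ g⁻¹ * k * g ∈ H := by
    intro g k
    rw [φa, eq_comm, QuotientGroup.eq, mul_assoc]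
  -- injectivity
  have hinj : Function.Injective φ := by
    rw [injective_iff_map_eq_one]
    intro k hk
    have h1 : ∀ g : Q, g⁻¹ * k * g ∈ H := by
      intro g
      rw [← fixx, hk]; rfl
    apply hρ
    rw [map_one]
    ext ω
    obtain ⟨q, rfl⟩ := hΩ ω
    have h2 := (hst _ (h1 q)).2 (by
      have := h1 (q * t)
      rw [mul_inv_rev, tinv] at this
      simpa [mul_assoc] using this)
    have h3 : ρ (q * (q⁻¹ * k * q)) (ι a0) = ρ q (ι a0) := by
      rw [map_mul, Perm.mul_apply, h2]
    have h4 : q * (q⁻¹ * k * q) = k * q := by group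
    rw [h4, map_mul, Perm.mul_apply] at h3
    simpa using h3
  have hinv1 : ∀ (g : Q) (u v), Δ.Adj u v → Δ.Adj (φ g u) (φ g v) := by
    rintro g u v ⟨k, rfl, rfl⟩
    exact ⟨g * k, φa _ _, by rw [φa, mul_assoc]⟩
  have hinv : ∀ (g : Q) (u v), Δ.Adj (φ g u) (φ g v) ↔ Δ.Adj u v := by
    intro g u v
    refine ⟨fun h => ?_, hinv1 g u v⟩
    have := hinv1 g⁻¹ _ _ h
    simpa only [← Perm.mul_apply, ← map_mul, inv_mul_cancel, map_one, Perm.one_apply] using this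
  have harc : ∀ u v u' v', Δ.Adj u v → Δ.Adj u' v' → ∃ g : Q, φ g u = u' ∧ φ g v = v' := by
    rintro u v u' v' ⟨g, rfl, rfl⟩ ⟨k, rfl, rfl⟩
    exact ⟨k * g⁻¹, by rw [φa]; group, by rw [φa]; group⟩
  have hconn : Δ.Connected := by
    have key : ∀ g : Q, ∀ k : Q, Δ.Reachable ((k : Q) : Q ⧸ H) ((k * g : Q) : Q ⧸ H) := by
      intro g
      have hg : g ∈ Subgroup.closure (insert t (H : Set Q)) := by rw [gen]; trivial
      induction hg using Subgroup.closure_induction with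
      | mem x hx =>
        intro k
        rcases hx with rfl | hx
        · exact SimpleGraph.Adj.reachable ⟨k, rfl, rfl⟩
        · have : ((k : Q) : Q ⧸ H) = ((k * x : Q) : Q ⧸ H) := by
            rw [QuotientGroup.eq]; simpa using hx
          rw [← this]
      | one => intro k; rw [mul_one]
      | mul x y _ _ hx hy =>
        intro k
        rw [← mul_assoc]
        exact (hx k).trans (hy _)
      | inv x _ hx =>
        intro k
        have := hx (k * x⁻¹)
        rw [inv_mul_cancel_right] at this
        exact this.symm
    have : Nonempty (Q ⧸ H) := ⟨((1 : Q) : Q ⧸ H)⟩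
    refine ⟨fun u v => ?_⟩
    induction u using QuotientGroup.induction_on with | H u => ?_
    induction v using QuotientGroup.induction_on with | H v => ?_
    have := key (u⁻¹ * v) u
    rwa [mul_inv_cancel_left] at this
  choose c hcH hc using htr
  have nb : ∀ (g : Q) (v : Q ⧸ H), Δ.Adj (g : Q ⧸ H) v ↔ ∃ h ∈ H, v = ((g * h * t : Q) : Q ⧸ H) := by
    intro g v
    constructor
    · rintro ⟨k, hk, rfl⟩
      rw [QuotientGroup.eq] at hk
      exact ⟨g⁻¹ * k, hk, by rw [mul_inv_cancel_left]⟩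
    · rintro ⟨h, hh, rfl⟩
      refine ⟨g * h, ?_, rfl⟩
      rw [QuotientGroup.eq]; simpa using hh
  have key : ∀ (g h : Q) (a : A), h ∈ H →
      (((g * h * t : Q) : Q ⧸ H) = ((g * c a * t : Q) : Q ⧸ H) ↔ ρ h (ι a0) = ι a) := by
    intro g h a hh
    rw [eq_comm, QuotientGroup.eq]
    have e1 : (g * c a * t)⁻¹ * (g * h * t) = t * ((c a)⁻¹ * h) * t := by
      rw [mul_inv_rev, tinv]; group
    rw [e1, ← hst _ (H.mul_mem (H.inv_mem (hcH a)) hh), map_mul, Perm.mul_apply, map_inv,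
      Perm.inv_eq_iff_eq, hc]
  have hE : ∀ g : Q, ∃ E : A ≃ Δ.neighborSet (g : Q ⧸ H), ∀ a, ((E a : Q ⧸ H)) = ((g * c a * t : Q) : Q ⧸ H) := by
    intro g
    refine ⟨Equiv.ofBijective (fun a => ⟨((g * c a * t : Q) : Q ⧸ H), (nb g _).2 ⟨_, hcH a, rfl⟩⟩) ⟨?_, ?_⟩,
      fun a => rfl⟩
    · intro a b hab
      have := congrArg Subtype.val hab
      rw [key g _ b (hcH a), hc] at this
      exact hι this
    · rintro ⟨v, hv⟩
      obtain ⟨h, hh, rfl⟩ := (nb g _).1 hv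
      obtain ⟨b, hb⟩ := hHι h hh a0
      exact ⟨b, Subtype.ext ((key g h b hh).2 hb).symm⟩
  choose E hE using hE
  have act : ∀ (g k : Q) (a b : A), g⁻¹ * k * g ∈ H →
      (φ k (E g a : Q ⧸ H) = (E g b : Q ⧸ H) ↔ ρ (g⁻¹ * k * g) (ι a) = ι b) := by
    intro g k a b hk
    rw [hE, hE, φa]
    have : k * (g * c a * t) = g * ((g⁻¹ * k * g) * c a) * t := by group
    rw [this, key g _ b (H.mul_mem hk (hcH a)), map_mul ρ _ (c a), Perm.mul_apply, hc]
  have hker : ∀ (g k : Q), k ∈ ker1 Δ φ (g : Q ⧸ H) ↔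
      (g⁻¹ * k * g ∈ H ∧ ∀ a, ρ (g⁻¹ * k * g) (ι a) = ι a) := by
    intro g k
    rw [mem_ker1, fixx]
    refine and_congr_right fun hk => ?_
    rw [← (E g).forall_congr_right]
    exact forall_congr' fun a => act g k a a hk
  refine ⟨Q ⧸ H, Fintype.ofFinite _, Δ, φ, hinj, hinv, hconn, harc, ?_, ?_⟩
  · intro x
    induction x using QuotientGroup.induction_on with | H g => ?_
    rw [← Nat.card_coe_set_eq]
    exact Nat.card_congr (E g).symm
  · rintro x y ⟨g, rfl, rfl⟩
    have hcinj : Function.Injective (ρ.comp (MulAut.conj g⁻¹).toMonoidHom) :=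
      hρ.comp (MulAut.conj g⁻¹).injective
    have hcv : ∀ k, (ρ.comp (MulAut.conj g⁻¹).toMonoidHom) k = ρ (g⁻¹ * k * g) := by
      intro k; simp
    refine ⟨⟨(E g).symm, ?_⟩, ?_, ?_⟩
    · ext σ
      simp only [Set.mem_ofPred_eq]
      constructor
      · rintro ⟨k, hk, hσ⟩
        rw [fixx] at hk
        refine ⟨_, hk, fun a => ?_⟩
        obtain ⟨b, hb⟩ := hHι _ hk a
        have := hσ (E g a) (E g b) ((act g k a b hk).2 hb)
        simp only [Equiv.symm_apply_apply] at this
        rw [this, hb]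
      · rintro ⟨h, hh, hσ⟩
        have e1 : g⁻¹ * (g * h * g⁻¹) * g = h := by group
        refine ⟨g * h * g⁻¹, by rw [fixx, e1]; exact hh, fun v w hvw => ?_⟩
        obtain ⟨a, rfl⟩ := (E g).surjective v
        obtain ⟨b, rfl⟩ := (E g).surjective w
        rw [act g _ a b (by rw [e1]; exact hh), e1, hσ] at hvw
        simpa using hι hvw
    · refine equiv_of_range _ hcinj Θ1 hΘ1 _ fun x => ?_
      rw [hr1]
      constructor
      · rintro ⟨k, hk, rfl⟩
        have e1 : g⁻¹ * (g * k * g⁻¹) * g = k := by group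
        exact ⟨g * k * g⁻¹, by rw [hker, e1]; exact hk, by rw [hcv, e1]⟩
      · rintro ⟨k, hk, rfl⟩
        rw [hker] at hk
        exact ⟨_, hk, (hcv k).symm⟩
    · refine equiv_of_range _ hcinj Θ2 hΘ2 _ fun x => ?_
      rw [hr2]
      have e2 : ∀ k, (g * t)⁻¹ * k * (g * t) = t * (g⁻¹ * k * g) * t := by
        intro k; rw [mul_inv_rev, tinv]; group
      constructor
      · rintro ⟨k, hk, rfl⟩
        have e1 : g⁻¹ * (g * k * g⁻¹) * g = k := by group
        exact ⟨g * k * g⁻¹, by rw [Subgroup.mem_inf, hker, hker, e2, e1]; exact hk, by rw [hcv, e1]⟩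
      · rintro ⟨k, hk, rfl⟩
        rw [Subgroup.mem_inf, hker, hker, e2] at hk
        exact ⟨_, hk, (hcv k).symm⟩
section concrete

/-- The point set. -/
abbrev Om (I J B : Type) (l : B) : Type := (I × J × B) ⊕ {b : B // b ≠ l}

variable {I J B : Type} {l : B}

/-- Elements of the vertex stabiliser. -/
def mkP (τ : Perm I) (F : I → J → Perm B) (k : Perm B) (hk : k l = l) : Perm (Om I J B l) where
  toFun := Sum.elim (fun x => Sum.inl (τ x.1, x.2.1, F x.1 x.2.1 x.2.2))
    (fun b => Sum.inr ⟨k b.1, fun h => b.2 (k.injective (h.trans hk.symm))⟩)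
  invFun := Sum.elim (fun x => Sum.inl (τ⁻¹ x.1, x.2.1, (F (τ⁻¹ x.1) x.2.1)⁻¹ x.2.2))
    (fun b => Sum.inr ⟨k⁻¹ b.1, fun h => b.2 (by rw [Perm.inv_eq_iff_eq, hk] at h; exact h)⟩)
  left_inv := by
    rintro (⟨i, j, b⟩ | ⟨b, hb⟩) <;> simp
  right_inv := by
    rintro (⟨i, j, b⟩ | ⟨b, hb⟩) <;> simp

@[simp] lemma mkP_inl (τ : Perm I) (F : I → J → Perm B) (k : Perm B) (hk : k l = l) (i : I) (j : J)
    (b : B) : mkP τ F k hk (Sum.inl (i, j, b)) = Sum.inl (τ i, j, F i j b) := rfl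

@[simp] lemma mkP_inr (τ : Perm I) (F : I → J → Perm B) (k : Perm B) (hk : k l = l)
    (b : {b : B // b ≠ l}) : mkP τ F k hk (Sum.inr b) =
      Sum.inr ⟨k b.1, fun h => b.2 (k.injective (h.trans hk.symm))⟩ := rfl

lemma mkP_mul (τ τ' : Perm I) (F F' : I → J → Perm B) (k k' : Perm B) (hk : k l = l)
    (hk' : k' l = l) : mkP τ F k hk * mkP τ' F' k' hk' =
      mkP (τ * τ') (fun i j => F (τ' i) j * F' i j) (k * k') (by simp [hk, hk']) := by
  ext1 x
  rcases x with ⟨i, j, b⟩ | ⟨b, hb⟩ <;> simp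

lemma mkP_one : mkP (1 : Perm I) (fun (_ : I) (_ : J) => (1 : Perm B)) 1 (l := l) rfl = 1 := by
  ext1 x
  rcases x with ⟨i, j, b⟩ | ⟨b, hb⟩ <;> rfl

/-- The vertex stabiliser. -/
def HH (R : Subgroup (Perm B)) (S : Subgroup (Perm I)) (J : Type) (l : B) :
    Subgroup (Perm (Om I J B l)) where
  carrier := {σ | ∃ τ ∈ S, ∃ F : I → J → Perm B, (∀ i j, F i j ∈ R) ∧ ∃ k ∈ R, ∃ hk : k l = l,
    σ = mkP τ F k hk}
  one_mem' := ⟨1, S.one_mem, fun _ _ => 1, fun _ _ => R.one_mem, 1, R.one_mem, rfl, mkP_one.symm⟩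
  mul_mem' := by
    rintro _ _ ⟨τ, hτ, F, hF, k, hkR, hk, rfl⟩ ⟨τ', hτ', F', hF', k', hkR', hk', rfl⟩
    exact ⟨_, S.mul_mem hτ hτ', _, fun i j => R.mul_mem (hF _ _) (hF' _ _), _,
      R.mul_mem hkR hkR', _, mkP_mul _ _ _ _ _ _ _ _⟩
  inv_mem' := by
    rintro _ ⟨τ, hτ, F, hF, k, hkR, hk, rfl⟩
    refine ⟨τ⁻¹, S.inv_mem hτ, fun i j => (F (τ⁻¹ i) j)⁻¹, fun i j => R.inv_mem (hF _ _), k⁻¹,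
      R.inv_mem hkR, by rw [Perm.inv_eq_iff_eq, hk], ?_⟩
    rw [inv_eq_iff_mul_eq_one, mkP_mul, ← mkP_one]
    congr 1 <;> simp

lemma mem_HH {R : Subgroup (Perm B)} {S : Subgroup (Perm I)} {σ : Perm (Om I J B l)} :
    σ ∈ HH R S J l ↔ ∃ τ ∈ S, ∃ F : I → J → Perm B, (∀ i j, F i j ∈ R) ∧ ∃ k ∈ R, ∃ hk : k l = l,
    σ = mkP τ F k hk := Iff.rfl

variable [DecidableEq I] [DecidableEq J] [DecidableEq B] [CommRing J]

/-- The function of the edge-reversing involution. -/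
def tf (i₀ : I) : Om I J B l → Om I J B l :=
  Sum.elim (fun x => if x.1 = i₀ then (if x.2.1 = 0 then
      (if h : x.2.2 = l then Sum.inl (i₀, 0, l) else Sum.inr ⟨x.2.2, h⟩)
      else Sum.inl (i₀, - x.2.1, x.2.2)) else Sum.inl (x.1, 1 - x.2.1, x.2.2))
    (fun b => Sum.inl (i₀, 0, b.1))

lemma tf_inr (i₀ : I) (b : {b : B // b ≠ l}) :
    tf (J := J) i₀ (Sum.inr b) = Sum.inl (i₀, 0, b.1) := rfl
lemma tf_p (i₀ : I) : tf (J := J) (l := l) i₀ (Sum.inl (i₀, 0, l)) = Sum.inl (i₀, 0, l) := by simp [tf]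
lemma tf_b (i₀ : I) (b : B) (hb : b ≠ l) :
    tf (J := J) i₀ (Sum.inl (i₀, 0, b)) = Sum.inr ⟨b, hb⟩ := by simp [tf, hb]
lemma tf_0 (i₀ : I) (j : J) (hj : j ≠ 0) (b : B) :
    tf (l := l) i₀ (Sum.inl (i₀, j, b)) = Sum.inl (i₀, - j, b) := by simp [tf, hj]
lemma tf_i (i₀ : I) (i : I) (hi : i ≠ i₀) (j : J) (b : B) :
    tf (l := l) i₀ (Sum.inl (i, j, b)) = Sum.inl (i, 1 - j, b) := by simp [tf, hi]

/-- Case principle for points. -/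
lemma om_cases (i₀ : I) {P : Om I J B l → Prop} (hp : P (Sum.inl (i₀, 0, l)))
    (hb : ∀ b, b ≠ l → P (Sum.inl (i₀, 0, b))) (h0 : ∀ j b, j ≠ 0 → P (Sum.inl (i₀, j, b)))
    (hi : ∀ i j b, i ≠ i₀ → P (Sum.inl (i, j, b))) (hr : ∀ b, P (Sum.inr b)) (x) : P x := by
  rcases x with ⟨i, j, b⟩ | b
  · by_cases h : i = i₀
    · subst h
      by_cases h : j = 0
      · subst h
        by_cases h : b = l
        · subst h; exact hp
        · exact hb b h
      · exact h0 j b h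
    · exact hi i j b h
  · exact hr b

lemma tf_tf (i₀ : I) (x : Om I J B l) : tf i₀ (tf i₀ x) = x := by
  revert x
  refine om_cases i₀ ?_ ?_ ?_ ?_ ?_
  · rw [tf_p, tf_p]
  · intro b h
    rw [tf_b _ _ h, tf_inr]
  · intro j b h
    rw [tf_0 _ _ h, tf_0 _ _ (neg_ne_zero.2 h), neg_neg]
  · intro i j b h
    rw [tf_i _ _ h, tf_i _ _ h, sub_sub_cancel]
  · intro b
    rw [tf_inr, tf_b _ _ b.2]

/-- The edge-reversing involution. -/
def tt (i₀ : I) : Perm (Om I J B l) := ⟨tf i₀, tf i₀, tf_tf i₀, tf_tf i₀⟩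

lemma tt_ap (i₀ : I) (x : Om I J B l) : tt i₀ x = tf i₀ x := rfl

lemma tt_tt (i₀ : I) : tt i₀ * tt i₀ = (1 : Perm (Om I J B l)) := by
  ext1 x; exact tf_tf i₀ x

lemma conj_tt (i₀ : I) (τ : Perm I) (F : I → J → Perm B) (k : Perm B) (hk : k l = l)
    (hτ : τ i₀ = i₀) (hF : F i₀ 0 l = l) :
    tt i₀ * mkP τ F k hk * tt i₀ = mkP τ (fun i j => if i = i₀ then (if j = 0 then k else F i₀ (-j))
      else F i (1 - j)) (F i₀ 0) hF := by
  ext1 x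
  simp only [Perm.mul_apply, tt_ap]
  revert x
  refine om_cases i₀ ?_ ?_ ?_ ?_ ?_
  · rw [tf_p, mkP_inl, mkP_inl, hτ, hF, tf_p]; simp [hk]
  · intro b h
    have : k b ≠ l := fun h' => h (k.injective (h'.trans hk.symm))
    rw [tf_b _ _ h, mkP_inr, tf_inr]; simp [hτ]
  · intro j b h
    rw [tf_0 _ _ h, mkP_inl, hτ, tf_0 _ _ (neg_ne_zero.2 h)]; simp [hτ, h]
  · intro i j b h
    have : τ i ≠ i₀ := fun h' => h (τ.injective (h'.trans hτ.symm))
    rw [tf_i _ _ h, mkP_inl, tf_i _ _ this]; simp [h]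
  · intro b
    have : F i₀ 0 b ≠ l := fun h' => b.2 ((F i₀ 0).injective (h'.trans hF.symm))
    rw [tf_inr, mkP_inl, hτ, tf_b _ _ this]; simp

lemma stab_iff (R : Subgroup (Perm B)) (S : Subgroup (Perm I)) (hB : ∃ b, b ≠ l) (i₀ : I)
    (h : Perm (Om I J B l))
    (hh : h ∈ HH R S J l) : h (Sum.inl (i₀, 0, l)) = Sum.inl (i₀, 0, l) ↔
      tt i₀ * h * tt i₀ ∈ HH R S J l := by
  obtain ⟨τ, hτ, F, hF, k, hkR, hk, rfl⟩ := hh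
  constructor
  · intro h
    simp only [mkP_inl, Sum.inl.injEq, Prod.mk.injEq, true_and] at h
    rw [conj_tt i₀ τ F k hk h.1 h.2]
    refine ⟨τ, hτ, _, fun i j => ?_, _, hF i₀ 0, _, rfl⟩
    split_ifs
    exacts [hkR, hF _ _, hF _ _]
  · rintro ⟨τ', hτ', F', hF', k', hkR', hk', h⟩
    obtain ⟨b, hb⟩ := hB
    have h1 := congrArg (tt i₀) (Equiv.congr_fun h (Sum.inr ⟨b, hb⟩))
    simp only [Perm.mul_apply, tt_ap, tf_tf, tf_inr, mkP_inl, mkP_inr, Sum.inl.injEq, Prod.mk.injEq] at h1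
    have hτ0 := h1.1
    have h2 := Equiv.congr_fun h (Sum.inl (i₀, 0, l))
    simp only [Perm.mul_apply, tt_ap, tf_p, mkP_inl, hτ0] at h2
    by_cases hb' : F i₀ 0 l = l
    · rw [mkP_inl, hb', hτ0]
    · rw [tf_b _ _ hb'] at h2
      cases h2

lemma fix_iff (R : Subgroup (Perm B)) (S : Subgroup (Perm I)) (x : Perm (Om I J B l)) :
    (x ∈ HH R S J l ∧ ∀ a : B × I, x (Sum.inl (a.2, 0, a.1)) = Sum.inl (a.2, 0, a.1)) ↔
    ∃ F : I → J → Perm B, (∀ i j, F i j ∈ R) ∧ (∀ i, F i 0 = 1) ∧ ∃ k ∈ R, ∃ hk : k l = l,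
      x = mkP 1 F k hk := by
  constructor
  · rintro ⟨⟨τ, hτ, F, hF, k, hkR, hk, rfl⟩, h⟩
    simp only [mkP_inl, Sum.inl.injEq, Prod.mk.injEq, true_and, Prod.forall] at h
    have : τ = 1 := by ext1 i; exact (h l i).1
    subst this
    exact ⟨F, hF, fun i => by ext1 b; exact (h b i).2, k, hkR, hk, rfl⟩
  · rintro ⟨F, hF, hF0, k, hkR, hk, rfl⟩
    exact ⟨⟨1, S.one_mem, F, hF, k, hkR, hk, rfl⟩, fun a => by simp [hF0]⟩

lemma stab_prop (R : Subgroup (Perm B)) (l : B) (k : ↥(R ⊓ MulAction.stabilizer (Perm B) l)) :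
    (k : Perm B) l = l := (Subgroup.mem_inf.1 k.2).2

/-- Parametrisation of subgroups of the base group. -/
def Th (R : Subgroup (Perm B)) (l : B) (q : I × J → Prop) [DecidablePred q] :
    ({ij : I × J // q ij} → R) × ↥(R ⊓ MulAction.stabilizer (Perm B) l) →* Perm (Om I J B l) where
  toFun y := mkP 1 (fun i j => if h : q (i, j) then (y.1 ⟨(i, j), h⟩ : Perm B) else 1) y.2 (stab_prop R l y.2)
  map_one' := by
    rw [← mkP_one]
    congr 1
    ext1 i; ext1 j
    split_ifs <;> simp
  map_mul' y z := by
    rw [mkP_mul]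
    congr 1
    ext1 i; ext1 j
    by_cases h : q (i, j) <;> simp [h]

lemma Th_apply (R : Subgroup (Perm B)) (l : B) (q : I × J → Prop) [DecidablePred q]
    (f : {ij : I × J // q ij} → R) (k : ↥(R ⊓ MulAction.stabilizer (Perm B) l)) :
    Th R l q (f, k) = mkP 1 (fun i j => if h : q (i, j) then (f ⟨(i, j), h⟩ : Perm B) else 1) k
      (stab_prop R l k) := rfl

lemma Th_inl_apply (R : Subgroup (Perm B)) (l : B) (q : I × J → Prop) [DecidablePred q]
    (f : {ij : I × J // q ij} → R) :
    ((Th R l q).comp (MonoidHom.inl _ _)) f =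
      mkP 1 (fun i j => if h : q (i, j) then (f ⟨(i, j), h⟩ : Perm B) else 1) 1 rfl := rfl

lemma Th_inj (R : Subgroup (Perm B)) (q : I × J → Prop) [DecidablePred q] :
    Function.Injective (Th (I := I) (J := J) R l q) := by
  rintro ⟨f, k⟩ ⟨f', k'⟩ h
  have h1 : ∀ x, Th R l q (f, k) x = Th R l q (f', k') x := fun x => by rw [h]
  refine Prod.ext ?_ ?_
  · ext ⟨⟨i, j⟩, hq⟩ b
    have := h1 (Sum.inl (i, j, b))
    simpa [Th, hq] using this
  · ext b
    by_cases hb : b = l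
    · subst hb
      exact (stab_prop R b k).trans (stab_prop R b k').symm
    · have := h1 (Sum.inr ⟨b, hb⟩)
      simpa [Th] using this

lemma range1 (R : Subgroup (Perm B)) (S : Subgroup (Perm I)) (x : Perm (Om I J B l)) :
    (∃ y, Th R l (fun ij : I × J => ij.2 ≠ 0) y = x) ↔
    (x ∈ HH R S J l ∧ ∀ a : B × I, x (Sum.inl (a.2, 0, a.1)) = Sum.inl (a.2, 0, a.1)) := by
  rw [fix_iff]
  constructor
  · rintro ⟨⟨f, k⟩, rfl⟩
    rw [Th_apply]
    refine ⟨_, fun i j => ?_, fun i => ?_, k, (Subgroup.mem_inf.1 k.2).1, stab_prop R l k, rfl⟩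
    · split_ifs
      exacts [(f _).2, R.one_mem]
    · simp
  · rintro ⟨F, hF, hF0, k, hkR, hk, rfl⟩
    refine ⟨(fun ij => ⟨F ij.1.1 ij.1.2, hF _ _⟩, ⟨k, hkR, hk⟩), ?_⟩
    rw [Th_apply]
    congr 1
    ext1 i; ext1 j
    by_cases h : j = 0
    · simp [h, hF0]
    · simp [h]

lemma range2 (R : Subgroup (Perm B)) (S : Subgroup (Perm I)) (i₀ : I) (x : Perm (Om I J B l)) :
    (∃ y, ((Th R l (fun ij : I × J => ij.2 ≠ 0 ∧ (ij.2 = 1 → ij.1 = i₀))).comp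
      (MonoidHom.inl _ _)) y = x) ↔
    ((x ∈ HH R S J l ∧ ∀ a : B × I, x (Sum.inl (a.2, 0, a.1)) = Sum.inl (a.2, 0, a.1)) ∧
     (tt i₀ * x * tt i₀ ∈ HH R S J l ∧
      ∀ a : B × I, (tt i₀ * x * tt i₀ : Perm (Om I J B l)) (Sum.inl (a.2, 0, a.1)) = Sum.inl (a.2, 0, a.1))) := by
  rw [fix_iff]
  constructor
  · rintro ⟨f, rfl⟩
    have hR : ∀ i j, (if h : j ≠ 0 ∧ (j = 1 → i = i₀) then (f ⟨(i, j), h⟩ : Perm B) else 1) ∈ R := by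
      intro i j
      split_ifs
      exacts [(f _).2, R.one_mem]
    rw [Th_inl_apply]
    refine ⟨⟨_, hR, fun i => by simp, 1, R.one_mem, rfl, rfl⟩, ?_⟩
    rw [conj_tt i₀ 1 _ 1 rfl rfl (by simp)]
    rw [fix_iff]
    refine ⟨_, fun i j => ?_, fun i => ?_, _, hR _ _, _, rfl⟩
    · split_ifs
      exacts [R.one_mem, (f _).2, R.one_mem, (f _).2, R.one_mem]
    · by_cases hi : i = i₀ <;> simp [hi]
  · rintro ⟨⟨F, hF, hF0, k, hkR, hk, rfl⟩, -, h⟩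
    rw [conj_tt i₀ 1 _ k hk rfl (by simp [hF0])] at h
    simp only [mkP_inl, Sum.inl.injEq, Prod.mk.injEq, true_and, Prod.forall, Perm.one_apply] at h
    have hk1 : k = 1 := by ext1 b; simpa using h b i₀
    subst hk1
    have hF1 : ∀ i, i ≠ i₀ → F i 1 = 1 := fun i hi => by
      ext1 b; simpa [hi] using h b i
    refine ⟨fun ij => ⟨F ij.1.1 ij.1.2, hF _ _⟩, ?_⟩
    rw [Th_inl_apply]
    congr 1
    ext1 i; ext1 j
    by_cases h0 : j = 0
    · simp [h0, hF0]
    · by_cases h1 : j = 1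
      · by_cases hi : i = i₀
        · simp [h0, hi]
        · subst h1; simp [hi, hF1]
      · simp [h0, h1]

end concrete

lemma comm3 {Ω : Type} [Fintype Ω] [DecidableEq Ω] (g h : Perm Ω) (p : Ω) (hg : g p ≠ p) (hh : h p ≠ p)
    (H : ∀ x, x ≠ p → g x = x ∨ h x = x) :
    g * h * g⁻¹ * h⁻¹ = swap (h p) (g p) * swap (h p) p ∧ g p ≠ h p := by
  have gx : ∀ x, g x ≠ x → x ≠ p → h x = x := fun x h1 h2 => (H x h2).resolve_left h1
  have hx : ∀ x, h x ≠ x → x ≠ p → g x = x := fun x h1 h2 => (H x h2).resolve_right h1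
  have h1 : h (g p) = g p := gx _ (fun h => hg (g.injective h)) hg
  have g1 : g (h p) = h p := hx _ (fun h' => hh (h.injective h')) hh
  have hne : g p ≠ h p := by
    intro h'
    rw [h', ← Perm.eq_inv_iff_eq] at h1
    simp at h1
    exact hh h1
  refine ⟨?_, hne⟩
  have h2 : h (g⁻¹ p) = g⁻¹ p := gx _ (fun h' => by
      rw [Perm.eq_inv_iff_eq, ← Perm.mul_apply, ← Perm.mul_apply, mul_inv_cancel_right] at h'; exact hg h')
    (fun h' => by rw [Perm.inv_eq_iff_eq] at h'; exact hg h'.symm)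
  have g2 : g (h⁻¹ p) = h⁻¹ p := hx _ (fun h' => by
      rw [Perm.eq_inv_iff_eq, ← Perm.mul_apply, ← Perm.mul_apply, mul_inv_cancel_right] at h'; exact hh h')
    (fun h' => by rw [Perm.inv_eq_iff_eq] at h'; exact hh h'.symm)
  suffices hs : g * h = swap (h p) (g p) * swap (h p) p * (h * g) by
    rw [mul_assoc, ← mul_inv_rev, hs, mul_inv_cancel_right]
  ext1 x
  simp only [Perm.mul_apply]
  by_cases e1 : x = p
  · subst e1
    rw [g1, h1, swap_apply_of_ne_of_ne hne hg, swap_apply_right]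
  by_cases e2 : g x = p
  · have hxx : h x = x := by rw [← e2] at h2; simpa using h2
    rw [hxx, e2, swap_apply_left, swap_apply_of_ne_of_ne hh.symm hg.symm]
  by_cases e3 : h x = p
  · have hxx : g x = x := by rw [← e3] at g2; simpa using g2
    rw [hxx, e3, swap_apply_right, swap_apply_left]
  have key : g (h x) = h (g x) := by
    rcases H x e1 with h' | h'
    · rw [h']
      exact (H (h x) e3).elim id (fun h'' => by rw [h.injective h'', h'] )
    · rw [h']
      exact ((H (g x) e2).elim (fun h'' => by rw [g.injective h'', h']) Eq.symm)
  rw [key]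
  have n1 : h (g x) ≠ h p := fun h' => e2 (h.injective h')
  have n2 : h (g x) ≠ g p := fun h' => e1 (g.injective (h.injective (h'.trans h1.symm)))
  by_cases n3 : h (g x) = p
  · exfalso
    rcases H x e1 with h' | h'
    · rw [h'] at n3; exact e3 n3
    · rw [← key, h'] at n3; exact e2 n3
  · rw [swap_apply_of_ne_of_ne n1 n3, swap_apply_of_ne_of_ne n1 n2]

lemma transi_of {Ω : Type} (T : Set (Perm Ω)) (p : Ω)
    (hX : ∀ X : Set Ω, p ∈ X → (∀ g ∈ T, ∀ x ∈ X, g x ∈ X) → ∀ x, x ∈ X) (x : Ω) :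
    ∃ g ∈ Subgroup.closure T, g p = x := by
  refine hX {x | ∃ g ∈ Subgroup.closure T, g p = x} ⟨1, Subgroup.one_mem _, rfl⟩ ?_ x
  rintro g hg _ ⟨k, hk, rfl⟩
  exact ⟨g * k, Subgroup.mul_mem _ (Subgroup.subset_closure hg) hk, rfl⟩

open Pointwise in
lemma prim {Ω : Type} [Fintype Ω] [DecidableEq Ω] (T : Set (Perm Ω)) (p c e : Ω)
    (hpc : p ≠ c) (hpe : p ≠ e) (hce : c ≠ e)
    (h3 : swap e c * swap e p ∈ Subgroup.closure T)
    (hfix : ∀ g ∈ T, ∃ g₁ ∈ Subgroup.closure T, ∃ g₂ ∈ Subgroup.closure T, g = g₁ * g₂ ∧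
      (g₁ p = p ∨ g₁ e = e) ∧ (g₂ p = p ∨ g₂ e = e))
    (hX : ∀ X : Set Ω, p ∈ X → (∀ g ∈ T, ∀ x ∈ X, g x ∈ X) → ∀ x, x ∈ X) :
    alternatingGroup Ω ≤ Subgroup.closure T := by
  have hpt : MulAction.IsPretransitive (Subgroup.closure T) Ω := by
    constructor
    intro x y
    obtain ⟨g, hg, rfl⟩ := transi_of T p hX x
    obtain ⟨k, hk, rfl⟩ := transi_of T p hX y
    refine ⟨⟨k, hk⟩ * ⟨g, hg⟩⁻¹, ?_⟩
    change (k * g⁻¹) (g p) = k p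
    simp
  refine Perm.alternatingGroup_le_of_isPreprimitive_of_isThreeCycle_mem ?_
    (Perm.isThreeCycle_swap_mul_swap_same hce.symm hpe.symm hpc.symm) h3
  refine MulAction.IsPreprimitive.of_isTrivialBlock_base p ?_
  intro X hp hB
  by_cases hs : X.Subsingleton
  · exact Or.inl hs
  right
  rw [Set.not_subsingleton_iff] at hs
  obtain ⟨q, hq, hqp⟩ := hs.exists_ne p
  have inv : ∀ g ∈ Subgroup.closure T, ∀ x ∈ X, g x ∈ X → ∀ y ∈ X, g y ∈ X := by
    intro g hg x hx hgx y hy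
    have := hB.smul_eq_of_mem (g := ⟨g, hg⟩) hx hgx
    rw [← this]
    exact Set.smul_mem_smul_set hy
  set σ := swap e c * swap e p with hσ
  have sp : σ p = c := by
    simp [hσ]
  have sc : σ c = e := by
    rw [hσ, Perm.mul_apply, swap_apply_of_ne_of_ne hce hpc.symm, swap_apply_right]
  have se : σ e = p := by
    rw [hσ, Perm.mul_apply, swap_apply_left, swap_apply_of_ne_of_ne hpe hpc]
  have hσX : ∀ y ∈ X, σ y ∈ X := by
    by_cases h1 : q = c
    · exact inv σ h3 p hp (by rw [sp, ← h1]; exact hq)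
    by_cases h2 : q = e
    · exact inv σ h3 q hq (by rw [h2, se]; exact hp)
    · refine inv σ h3 q hq ?_
      rw [hσ, Perm.mul_apply, swap_apply_of_ne_of_ne h2 hqp, swap_apply_of_ne_of_ne h2 h1]
      exact hq
  have hc : c ∈ X := by rw [← sp]; exact hσX _ hp
  have he : e ∈ X := by rw [← sc]; exact hσX _ hc
  have hf : ∀ g ∈ Subgroup.closure T, (g p = p ∨ g e = e) → ∀ x ∈ X, g x ∈ X := by
    rintro g hg (h | h)
    · exact inv g hg p hp (by rw [h]; exact hp)
    · exact inv g hg e he (by rw [h]; exact he)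
  rw [Set.eq_univ_iff_forall]
  refine hX X hp ?_
  intro g hg x hx
  obtain ⟨g₁, hg₁, g₂, hg₂, rfl, f1, f2⟩ := hfix g hg
  exact hf g₁ hg₁ f1 _ (hf g₂ hg₂ f2 x hx)

lemma univ_of {I B : Type} {l : B} [DecidableEq I] [DecidableEq B] (m : ℕ) [NeZero m]
    (R : Subgroup (Perm B)) (S : Subgroup (Perm I))
    (hR : ∀ u v : B, ∃ g ∈ R, g u = v) (hS : ∀ u v : I, ∃ g ∈ S, g u = v) (i₀ i₁ : I) (hi : i₁ ≠ i₀)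
    (X : Set (Om I (ZMod m) B l)) (hp : Sum.inl (i₀, 0, l) ∈ X)
    (hX : ∀ g ∈ insert (tt i₀) (HH R S (ZMod m) l : Set (Perm (Om I (ZMod m) B l))),
      ∀ x ∈ X, g x ∈ X) (x : Om I (ZMod m) B l) : x ∈ X := by
  have hH : ∀ i j b, Sum.inl (i, j, b) ∈ X → ∀ i' b', Sum.inl (i', j, b') ∈ X := by
    intro i j b h i' b'
    obtain ⟨τ, hτ, h1⟩ := hS i i'
    obtain ⟨g, hg, h2⟩ := hR b b'
    have := hX (mkP τ (fun _ _ => g) 1 (Perm.one_apply l))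
      (Or.inr ⟨τ, hτ, _, fun _ _ => hg, 1, R.one_mem, Perm.one_apply l, rfl⟩) _ h
    rwa [mkP_inl, h1, h2] at this
  have hT : ∀ x ∈ X, tf i₀ x ∈ X := fun x hx => hX _ (Or.inl rfl) x hx
  have hL : ∀ n : ℕ, ∀ i b, Sum.inl (i, (n : ZMod m), b) ∈ X := by
    intro n
    induction n with
    | zero => rw [Nat.cast_zero]; exact hH _ _ _ hp
    | succ n ih =>
      have h1 : Sum.inl (i₀, -(n : ZMod m), l) ∈ X := by
        by_cases h0 : (n : ZMod m) = 0
        · rw [h0, neg_zero]; exact hp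
        · have := hT _ (ih i₀ l)
          rwa [tf_0 _ _ h0] at this
      have h2 := hT _ (hH _ _ _ h1 i₁ l)
      rw [tf_i _ _ hi, sub_neg_eq_add, add_comm] at h2
      rw [Nat.cast_succ]
      exact hH _ _ _ h2
  have hL' : ∀ i (j : ZMod m) b, Sum.inl (i, j, b) ∈ X := by
    intro i j b
    have := hL j.val i b
    rwa [ZMod.natCast_zmod_val] at this
  rcases x with ⟨i, j, b⟩ | b
  · exact hL' i j b
  · have := hT _ (hL' i₀ 0 b.1)
    rwa [tf_b _ _ b.2] at this

lemma alt_le {I B : Type} {l : B} [Fintype I] [Fintype B] [DecidableEq I] [DecidableEq B]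
    (m : ℕ) [NeZero m]
    (R : Subgroup (Perm B)) (S : Subgroup (Perm I))
    (hR : ∀ u v : B, ∃ g ∈ R, g u = v) (hS : ∀ u v : I, ∃ g ∈ S, g u = v) (i₀ i₁ : I) (hi : i₁ ≠ i₀)
    (b₀ : B) (hb₀ : b₀ ≠ l) : alternatingGroup (Om I (ZMod m) B l) ≤
      Subgroup.closure (insert (tt i₀) (HH R S (ZMod m) l : Set (Perm (Om I (ZMod m) B l)))) := by
  set C := Subgroup.closure (insert (tt i₀) (HH R S (ZMod m) l : Set (Perm (Om I (ZMod m) B l))))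
    with hC
  have htC : tt i₀ ∈ C := Subgroup.subset_closure (Or.inl rfl)
  have hHC : ∀ h ∈ HH R S (ZMod m) l, h ∈ C := fun h hh => Subgroup.subset_closure (Or.inr hh)
  refine prim _ (Sum.inl (i₀, 0, l)) (Sum.inl (i₀, 0, b₀)) (Sum.inr ⟨b₀, hb₀⟩) ?_ ?_ ?_ ?_ ?_
    (univ_of m R S hR hS i₀ i₁ hi)
  · simpa using hb₀.symm
  · simp
  · simp
  · obtain ⟨γ, hγ, hγl⟩ := hR l b₀
    set g : Perm (Om I (ZMod m) B l) :=
      mkP 1 (fun i j => if i = i₀ ∧ j = 0 then γ else 1) 1 (Perm.one_apply l) with hg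
    have hgH : g ∈ HH R S (ZMod m) l := by
      refine ⟨1, S.one_mem, _, fun i j => ?_, 1, R.one_mem, Perm.one_apply l, rfl⟩
      split_ifs
      exacts [hγ, R.one_mem]
    have gp : g (Sum.inl (i₀, 0, l)) = Sum.inl (i₀, 0, b₀) := by simp [hg, hγl]
    set h := tt i₀ * g * tt i₀ with hh
    have hp : h (Sum.inl (i₀, 0, l)) = Sum.inr ⟨b₀, hb₀⟩ := by
      rw [hh, Perm.mul_apply, Perm.mul_apply, tt_ap, tt_ap, tf_p, gp, tf_b _ _ hb₀]
    have hhC : h ∈ C := C.mul_mem (C.mul_mem htC (hHC _ hgH)) htC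
    have := (comm3 g h (Sum.inl (i₀, 0, l)) (by rw [gp]; simpa using hb₀) (by rw [hp]; simp) (by
      refine om_cases i₀ ?_ ?_ ?_ ?_ ?_
      · intro h; exact absurd rfl h
      · intro b hb _
        right
        rw [hh, Perm.mul_apply, Perm.mul_apply, tt_ap, tt_ap, tf_b _ _ hb, hg, mkP_inr]
        exact tf_inr _ _
      · intro j b hj _
        left
        simp [hg, hj]
      · intro i j b hi _
        left
        simp [hg, hi]
      · intro b _
        left
        rfl)).1
    rw [gp, hp] at this
    rw [← this]
    exact C.mul_mem (C.mul_mem (C.mul_mem (hHC _ hgH) hhC) (C.inv_mem (hHC _ hgH))) (C.inv_mem hhC)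
  · rintro g (rfl | hg)
    · exact ⟨_, htC, 1, C.one_mem, (mul_one _).symm, Or.inl (tf_p i₀), Or.inl rfl⟩
    · obtain ⟨τ, hτ, F, hF, k, hkR, hk, rfl⟩ := hg
      refine ⟨mkP τ F 1 (Perm.one_apply l), hHC _ ⟨τ, hτ, F, hF, 1, R.one_mem, Perm.one_apply l, rfl⟩,
        mkP 1 (fun _ _ => 1) k hk,
        hHC _ ⟨1, S.one_mem, _, fun _ _ => R.one_mem, k, hkR, hk, rfl⟩, ?_, Or.inr rfl, Or.inl rfl⟩
      rw [mkP_mul]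
      rfl

lemma card_q1 (s m : ℕ) [NeZero m] :
    Fintype.card {ij : Fin s × ZMod m // ij.2 ≠ 0} = s * (m - 1) := by
  have e : {ij : Fin s × ZMod m // ij.2 ≠ 0} ≃ Fin s × {j : ZMod m // j ≠ 0} :=
    { toFun := fun x => (x.1.1, ⟨x.1.2, x.2⟩)
      invFun := fun y => ⟨(y.1, y.2.1), y.2.2⟩
      left_inv := fun _ => rfl
      right_inv := fun _ => rfl }
  rw [Fintype.card_congr e, Fintype.card_prod, Fintype.card_fin, Fintype.card_subtype_compl,
    ZMod.card, Fintype.card_subtype_eq]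

lemma card_q2 (s m : ℕ) [NeZero m] (h10 : (1 : ZMod m) ≠ 0) (i₀ : Fin s) :
    Fintype.card {ij : Fin s × ZMod m // ij.2 ≠ 0 ∧ (ij.2 = 1 → ij.1 = i₀)} = s * (m - 2) + 1 := by
  have e : {ij : Fin s × ZMod m // ij.2 ≠ 0 ∧ (ij.2 = 1 → ij.1 = i₀)} ≃
      (Fin s × {j : ZMod m // ¬ (j = 0 ∨ j = 1)}) ⊕ Unit :=
    { toFun := fun x => if h : x.1.2 = 1 then Sum.inr () else
        Sum.inl (x.1.1, ⟨x.1.2, fun h' => h'.elim x.2.1 h⟩)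
      invFun := Sum.elim (fun y => ⟨(y.1, y.2.1), fun h => y.2.2 (Or.inl h),
        fun h => absurd (Or.inr h) y.2.2⟩) (fun _ => ⟨(i₀, 1), h10, fun _ => rfl⟩)
      left_inv := by
        rintro ⟨⟨i, j⟩, h0, h1⟩
        by_cases h : j = 1
        · subst h
          have h2 : i = i₀ := h1 rfl
          subst h2
          simp
        · simp [h]
      right_inv := by
        rintro (⟨i, j, hj⟩ | _)
        · have : j ≠ 1 := fun h => hj (Or.inr h)
          simp [this]
        · simp }
  have h2 : Fintype.card {j : ZMod m // j = 0 ∨ j = 1} = 2 := by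
    rw [Fintype.card_subtype]
    have : (Finset.univ.filter fun j : ZMod m => j = 0 ∨ j = 1) = {0, 1} := by
      ext j; simp
    rw [this, Finset.card_pair h10.symm]
  rw [Fintype.card_congr e, Fintype.card_sum, Fintype.card_prod, Fintype.card_fin,
    Fintype.card_subtype_compl, ZMod.card, h2, Fintype.card_unit]

theorem stmt18 (r s m : ℕ) (hr : 1 < r) (hs : 1 < s) (hm : 3 ≤ m) (hmodd : Odd m)
    (R : Subgroup (Equiv.Perm (Fin r))) (S : Subgroup (Equiv.Perm (Fin s)))
    (hR : ∀ u v : Fin r, ∃ g ∈ R, g u = v) (hS : ∀ u v : Fin s, ∃ g ∈ S, g u = v) :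
    ∃ (V : Type) (_ : Fintype V) (Δ : SimpleGraph V)
      (G : Subgroup (Equiv.Perm (Fin (m * r * s + r - 1))))
      (φ : G →* Equiv.Perm V),
      alternatingGroup (Fin (m * r * s + r - 1)) ≤ G ∧
      Function.Injective φ ∧
      (∀ (g : G) (u v : V), Δ.Adj (φ g u) (φ g v) ↔ Δ.Adj u v) ∧
      Δ.Connected ∧
      (∀ u v u' v' : V, Δ.Adj u v → Δ.Adj u' v' → ∃ g : G, φ g u = u' ∧ φ g v = v') ∧
      (∀ x : V, (Δ.neighborSet x).ncard = r * s) ∧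
      ∀ x y : V, Δ.Adj x y →
        (∃ e : Δ.neighborSet x ≃ Fin r × Fin s,
          {σ : Equiv.Perm (Fin r × Fin s) | ∃ g : G, φ g x = x ∧
            ∀ v w : Δ.neighborSet x, φ g (v : V) = (w : V) → σ (e v) = e w} =
            wreathSet R S) ∧
        Nonempty (ker1 Δ φ x ≃*
          ((Fin (s * (m - 1)) → R) ×
            ↥(R ⊓ MulAction.stabilizer (Equiv.Perm (Fin r)) (⟨r - 1, by omega⟩ : Fin r)))) ∧
        Nonempty ((ker1 Δ φ x ⊓ ker1 Δ φ y : Subgroup G) ≃*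
          (Fin (s * (m - 2) + 1) → R)) := by
  classical
  have hm0 : NeZero m := ⟨by omega⟩
  have hm1 : Fact (1 < m) := ⟨by omega⟩
  have h10 : (1 : ZMod m) ≠ 0 := one_ne_zero
  set l : Fin r := ⟨r - 1, by omega⟩ with hl
  set i₀ : Fin s := ⟨0, by omega⟩ with hi₀
  have hi₁ : (⟨1, hs⟩ : Fin s) ≠ i₀ := by simp [hi₀]
  set b₀ : Fin r := ⟨0, by omega⟩ with hb₀'
  have hb₀ : b₀ ≠ l := by simp [hb₀', hl]; omega
  set H0 := HH R S (ZMod m) l with hH0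
  set t0 : Perm (Om (Fin s) (ZMod m) (Fin r) l) := tt i₀ with ht0
  set C := Subgroup.closure (insert t0 (H0 : Set (Perm (Om (Fin s) (ZMod m) (Fin r) l)))) with hC
  have hAlt : alternatingGroup _ ≤ C := alt_le m R S hR hS i₀ _ hi₁ b₀ hb₀
  have hcard : Fintype.card (Om (Fin s) (ZMod m) (Fin r) l) = m * r * s + r - 1 := by
    rw [Fintype.card_sum, Fintype.card_prod, Fintype.card_prod, Fintype.card_subtype_compl,
      Fintype.card_subtype_eq, ZMod.card, Fintype.card_fin, Fintype.card_fin,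
      show s * (m * r) = m * r * s by ring]
    omega
  let e := Fintype.equivFinOfCardEq hcard
  let ψ := e.symm.permCongrHom
  let G : Subgroup (Perm (Fin (m * r * s + r - 1))) := C.comap ψ.toMonoidHom
  let ρ : G →* Perm (Om (Fin s) (ZMod m) (Fin r) l) := ψ.toMonoidHom.comp G.subtype
  have hρ : Function.Injective ρ := ψ.injective.comp Subtype.val_injective
  have hρC : ∀ c ∈ C, ∃ q : G, ρ q = c := by
    intro c hc
    have h1 : ψ (ψ.symm c) = c := ψ.apply_symm_apply c
    refine ⟨⟨ψ.symm c, ?_⟩, h1⟩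
    change ψ (ψ.symm c) ∈ C
    rw [h1]; exact hc
  have hHC : H0 ≤ C := fun h hh => Subgroup.subset_closure (Or.inr hh)
  obtain ⟨t, ht⟩ := hρC t0 (Subgroup.subset_closure (Or.inl rfl))
  have htt : t0 * t0 = 1 := tt_tt i₀
  have htH0 : t0 ∉ H0 := by
    rintro ⟨τ, hτ, F, hF, k, hkR, hk, h⟩
    have := Equiv.congr_fun h (Sum.inr ⟨b₀, hb₀⟩)
    rw [ht0, tt_ap, tf_inr, mkP_inr] at this
    cases this
  let ι : Fin r × Fin s → Om (Fin s) (ZMod m) (Fin r) l := fun a => Sum.inl (a.2, 0, a.1)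
  have hH : ∀ q : G, q ∈ H0.comap ρ ↔ ρ q ∈ H0 := fun q => Iff.rfl
  have gen : Subgroup.closure (insert t (H0.comap ρ : Set G)) = ⊤ := by
    have h1 : (Subgroup.closure (insert t (H0.comap ρ : Set G))).map ρ = C := by
      rw [MonoidHom.map_closure, hC, Set.image_insert_eq, ht]
      congr 2
      ext x
      constructor
      · rintro ⟨q, hq, rfl⟩; exact hq
      · intro hx
        obtain ⟨q, rfl⟩ := hρC x (hHC hx)
        exact ⟨q, hx, rfl⟩
    rw [eq_top_iff]
    intro q _
    have hq : ρ q ∈ C := q.2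
    rw [← h1] at hq
    obtain ⟨q', hq', he⟩ := hq
    rw [← hρ he]; exact hq'
  obtain ⟨V, hV, Δ, φ, h1, h2, h3, h4, h5, h6⟩ := pkg ρ hρ (H0.comap ρ) t
    (hρ (by rw [map_mul, ht, htt, map_one])) (by rw [hH, ht]; exact htH0) gen ι
    (by rintro ⟨b, i⟩ ⟨b', i'⟩ h; simp only [ι, Sum.inl.injEq, Prod.mk.injEq, true_and] at h
        exact Prod.ext h.2 h.1)
    (l, i₀)
    (by
      rintro q hq a
      rw [hH] at hq
      obtain ⟨τ, hτ, F, hF, k, hkR, hk, h⟩ := hq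
      exact ⟨(F a.2 0 a.1, τ a.2), by rw [h]; rfl⟩)
    (by
      rintro ⟨b, i⟩
      obtain ⟨τ, hτ, e1⟩ := hS i₀ i
      obtain ⟨γ, hγ, e2⟩ := hR l b
      have hm' : mkP (l := l) τ (fun (_ : Fin s) (_ : ZMod m) => γ) 1 (Perm.one_apply l) ∈ H0 :=
        ⟨τ, hτ, _, fun _ _ => hγ, 1, R.one_mem, Perm.one_apply l, rfl⟩
      obtain ⟨q, hq⟩ := hρC _ (hHC hm')
      refine ⟨q, by rw [hH, hq]; exact hm', ?_⟩
      rw [hq]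
      change mkP _ _ _ _ (Sum.inl (i₀, 0, l)) = Sum.inl (i, 0, b)
      rw [mkP_inl, e1, e2])
    (by
      intro q hq
      rw [hH, map_mul, map_mul, ht]
      exact stab_iff R S ⟨b₀, hb₀⟩ i₀ (ρ q) hq)
    (by
      intro ω
      obtain ⟨c, hc, h⟩ := transi_of _ _ (univ_of m R S hR hS i₀ _ hi₁) ω
      obtain ⟨q, rfl⟩ := hρC c hc
      exact ⟨q, h⟩)
    (Th R l (fun ij : Fin s × ZMod m => ij.2 ≠ 0)) (Th_inj R _)
    ((Th R l (fun ij : Fin s × ZMod m => ij.2 ≠ 0 ∧ (ij.2 = 1 → ij.1 = i₀))).comp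
      (MonoidHom.inl _ _))
    (by
      rw [MonoidHom.coe_comp]
      exact (Th_inj R _).comp (fun f f' h => congrArg Prod.fst h))
    (by
      intro x
      rw [range1 R S]
      constructor
      · intro h
        obtain ⟨q, rfl⟩ := hρC x (hHC h.1)
        exact ⟨q, h, rfl⟩
      · rintro ⟨q, h, rfl⟩
        exact h)
    (by
      intro x
      rw [range2 R S]
      constructor
      · intro h
        obtain ⟨q, rfl⟩ := hρC x (hHC h.1.1)
        refine ⟨q, ?_, rfl⟩
        rw [hH, hH, map_mul, map_mul, ht]
        exact h
      · rintro ⟨q, h, rfl⟩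
        rw [hH, hH, map_mul, map_mul, ht] at h
        exact h)
  refine ⟨V, hV, Δ, G, φ, ?_, h1, h2, h3, h4, ?_, ?_⟩
  · intro σ hσ
    refine hAlt ?_
    rw [Perm.mem_alternatingGroup] at hσ ⊢
    rw [← hσ]
    exact Perm.sign_permCongr e.symm σ
  · intro x
    rw [h5, Nat.card_prod, Nat.card_fin, Nat.card_fin]
  · intro x y hxy
    obtain ⟨⟨E, hE⟩, ⟨k1⟩, ⟨k2⟩⟩ := h6 x y hxy
    refine ⟨⟨E, ?_⟩, ⟨k1.trans (MulEquiv.prodCongr (MulEquiv.arrowCongr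
      (Fintype.equivFinOfCardEq (card_q1 s m)) (MulEquiv.refl R)) (MulEquiv.refl _))⟩,
      ⟨k2.trans (MulEquiv.arrowCongr
      (Fintype.equivFinOfCardEq (card_q2 s m h10 i₀)) (MulEquiv.refl R))⟩⟩
    rw [hE]
    ext σ
    simp only [wreathSet, Set.mem_ofPred_eq]
    constructor
    · rintro ⟨q, hq, h⟩
      rw [hH] at hq
      obtain ⟨τ, hτ, F, hF, k, hkR, hk, hq'⟩ := hq
      refine ⟨τ, hτ, fun i => F i 0, fun i => hF i 0, fun p => ?_⟩
      have := h p
      rw [hq'] at this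
      simp only [ι, mkP_inl, Sum.inl.injEq, Prod.mk.injEq, true_and] at this
      exact Prod.ext this.2.symm this.1.symm
    · rintro ⟨τ, hτ, f, hf, h⟩
      have hm' : mkP (l := l) τ (fun (i : Fin s) (_ : ZMod m) => f i) 1 (Perm.one_apply l) ∈ H0 :=
        ⟨τ, hτ, _, fun i _ => hf i, 1, R.one_mem, Perm.one_apply l, rfl⟩
      obtain ⟨q, hq⟩ := hρC _ (hHC hm')
      refine ⟨q, by rw [hH, hq]; exact hm', fun a => ?_⟩
      rw [hq, h]
      rfl
end
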